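/- arXiv:1809.09226 — 3 statements merged into one kernel-verified Lean document; each statement's English description precedes it below -/
import Mathlib

section
/- Every proper subgroup of the simple group PSp4(F3) has index at least 27; in particular PSp4(F3) (of order 25920) has no proper subgroup of index between 2 and 26. -/
/-- The quasi-simple symplectic group `Sp₄(F₃)`. -/
abbrev Sp4F3 : Type := Matrix.symplecticGroup (Fin 2) (ZMod 3)

/-- The simple projective symplectic group `PSp₄(F₃) = Sp₄(F₃)/Z(Sp₄(F₃))`. -/
abbrev PSp4F3 : Type := Sp4F3 ⧸ Subgroup.center Sp4F3

section work
open Matrix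

abbrev VV : Type := Fin 2 ⊕ Fin 2 → ZMod 3

def om (u v : VV) : ZMod 3 := u ⬝ᵥ (J (Fin 2) (ZMod 3) *ᵥ v)

def vv4 (a b c d : ZMod 3) : VV := Sum.elim ![a, b] ![c, d]

lemma om_eq (u v : VV) : om u v =
    u (Sum.inr 0) * v (Sum.inl 0) + u (Sum.inr 1) * v (Sum.inl 1)
    - u (Sum.inl 0) * v (Sum.inr 0) - u (Sum.inl 1) * v (Sum.inr 1) := by
  simp [om, J, dotProduct, mulVec, Matrix.one_apply]
  ring

lemma vv4_surj (v : VV) : ∃ a b c d, v = vv4 a b c d :=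
  ⟨v (Sum.inl 0), v (Sum.inl 1), v (Sum.inr 0), v (Sum.inr 1), by
    ext i; rcases i with i | i <;> fin_cases i <;> rfl⟩

lemma om_vv4 (a b c d a' b' c' d' : ZMod 3) : om (vv4 a b c d) (vv4 a' b' c' d') =
    c * a' + d * b' - a * c' - b * d' := by
  rw [om_eq]; simp [vv4]

lemma om_add_left (u u' v : VV) : om (u + u') v = om u v + om u' v := by
  simp only [om_eq, Pi.add_apply]; ring
lemma om_smul_left (k : ZMod 3) (u v : VV) : om (k • u) v = k * om u v := by
  simp only [om_eq, Pi.smul_apply, smul_eq_mul]; ring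
lemma om_add_right (u u' v : VV) : om v (u + u') = om v u + om v u' := by
  simp only [om_eq, Pi.add_apply]; ring
lemma om_sub_right (u u' v : VV) : om v (u - u') = om v u - om v u' := by
  simp only [om_eq, Pi.sub_apply]; ring
lemma om_smul_right (k : ZMod 3) (u v : VV) : om v (k • u) = k * om v u := by
  simp only [om_eq, Pi.smul_apply, smul_eq_mul]; ring
lemma om_self (u : VV) : om u u = 0 := by
  simp only [om_eq]; ring
lemma om_swap (u v : VV) : om u v = - om v u := by
  simp only [om_eq]; ring

instance actV : MulAction Sp4F3 VV where
  smul g v := (g : Matrix _ _ (ZMod 3)) *ᵥ v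
  one_smul v := Matrix.one_mulVec v
  mul_smul _ _ v := (Matrix.mulVec_mulVec v _ _).symm

lemma smul_def' (g : Sp4F3) (v : VV) : g • v = (g : Matrix _ _ (ZMod 3)) *ᵥ v := rfl

lemma om_inv (g : Sp4F3) (u v : VV) : om (g • u) (g • v) = om u v := by
  have h := SymplecticGroup.mem_iff'.1 g.2
  simp only [om, smul_def']
  rw [← Matrix.vecMul_transpose, ← Matrix.dotProduct_mulVec]
  simp only [Matrix.mulVec_mulVec]
  rw [← Matrix.mul_assoc, h]

lemma g_add (g : Sp4F3) (u v : VV) : g • (u + v) = g • u + g • v := by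
  simp only [smul_def', Matrix.mulVec_add]
lemma g_smul (g : Sp4F3) (k : ZMod 3) (v : VV) : g • (k • v) = k • (g • v) := by
  simp only [smul_def', Matrix.mulVec_smul]
lemma g_sub (g : Sp4F3) (u v : VV) : g • (u - v) = g • u - g • v := by
  simp only [smul_def', Matrix.mulVec_sub]

lemma g_ext (g h : Sp4F3) (H : ∀ v : VV, g • v = h • v) : g = h := by
  apply Subtype.ext
  apply Matrix.ext_of_mulVec_single
  intro i
  exact H _

lemma mem_of_pres (A : Matrix (Fin 2 ⊕ Fin 2) (Fin 2 ⊕ Fin 2) (ZMod 3))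
    (h : ∀ u v : VV, om (A *ᵥ u) (A *ᵥ v) = om u v) : A ∈ symplecticGroup (Fin 2) (ZMod 3) := by
  rw [SymplecticGroup.mem_iff']
  ext i j
  have := h (Pi.single i 1) (Pi.single j 1)
  simp only [om] at this
  rw [← Matrix.vecMul_transpose, ← Matrix.dotProduct_mulVec] at this
  simp only [Matrix.mulVec_mulVec] at this
  rw [← Matrix.mul_assoc] at this
  simpa using this

/-- transvections -/
def TM (a : VV) (c : ZMod 3) : Matrix (Fin 2 ⊕ Fin 2) (Fin 2 ⊕ Fin 2) (ZMod 3) :=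
  1 + c • vecMulVec a (J (Fin 2) (ZMod 3) *ᵥ a)

lemma TM_mulVec (a : VV) (c : ZMod 3) (x : VV) : TM a c *ᵥ x = x + (c * om x a) • a := by
  rw [TM, Matrix.add_mulVec, Matrix.one_mulVec, Matrix.smul_mulVec, Matrix.vecMulVec_mulVec,
    dotProduct_comm]
  ext i
  simp [om]; ring

def TT (a : VV) (c : ZMod 3) : Sp4F3 := ⟨TM a c, mem_of_pres _ fun u v => by
  simp only [TM_mulVec, om_add_left, om_add_right, om_smul_left, om_smul_right, om_self]
  rw [om_swap a v]; ring⟩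

lemma TT_smul (a : VV) (c : ZMod 3) (x : VV) : TT a c • x = x + (c * om x a) • a := TM_mulVec a c x

lemma TT_conj (g : Sp4F3) (a : VV) (c : ZMod 3) : g * TT a c * g⁻¹ = TT (g • a) c := by
  rw [mul_inv_eq_iff_eq_mul]
  apply g_ext
  intro v
  simp only [mul_smul, TT_smul, g_add, g_smul, om_inv]

lemma TT_zero (c : ZMod 3) : TT 0 c = 1 := by
  apply g_ext; intro v; simp [TT_smul]

lemma TT_c_zero (a : VV) : TT a 0 = 1 := by
  apply g_ext; intro v; simp [TT_smul]

lemma TT_mul (a : VV) (c d : ZMod 3) : TT a c * TT a d = TT a (c + d) := by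
  apply g_ext; intro v
  rw [mul_smul]
  simp only [TT_smul, om_add_left, om_smul_left, om_self]
  rw [add_assoc, ← add_smul]; congr 2; ring

lemma move1 (u w : VV) (h : om u w ≠ 0) : TT (w - u) (om u w)⁻¹ • u = w := by
  rw [TT_smul, om_sub_right, om_self, sub_zero, inv_mul_cancel₀ h, one_smul]; abel

lemma move1_fix (u w f : VV) (c : ZMod 3) (h : om f u = om f w) : TT (w - u) c • f = f := by
  rw [TT_smul, om_sub_right, h, sub_self, mul_zero, zero_smul, add_zero]

lemma move2 (K : Subgroup Sp4F3) (hK : ∀ a c, TT a c ∈ K) (u w : VV)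
    (z : VV) (h1 : om u z ≠ 0) (h2 : om z w ≠ 0) :
    ∃ k ∈ K, k • u = w ∧ ∀ f, om f u = om f z → om f z = om f w → k • f = f := by
  refine ⟨TT (w - z) (om z w)⁻¹ * TT (z - u) (om u z)⁻¹, K.mul_mem (hK _ _) (hK _ _), ?_, ?_⟩
  · rw [mul_smul, move1 _ _ h1, move1 _ _ h2]
  · intro f hf hf'
    rw [mul_smul, move1_fix _ _ _ _ hf, move1_fix _ _ _ _ hf']

def e1 : VV := vv4 1 0 0 0
def e2 : VV := vv4 0 1 0 0
def f1 : VV := vv4 0 0 1 0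
def f2 : VV := vv4 0 0 0 1

lemma vv4_zero : vv4 0 0 0 0 = 0 := by
  ext i; rcases i with i | i <;> fin_cases i <;> rfl

lemma vv4_inj {a b c d a' b' c' d' : ZMod 3} : vv4 a b c d = vv4 a' b' c' d' ↔
    a = a' ∧ b = b' ∧ c = c' ∧ d = d' := by
  constructor
  · intro h
    exact ⟨congrFun h (Sum.inl 0), congrFun h (Sum.inl 1), congrFun h (Sum.inr 0),
      congrFun h (Sum.inr 1)⟩
  · rintro ⟨rfl, rfl, rfl, rfl⟩; rfl


lemma trans1 (K : Subgroup Sp4F3) (hK : ∀ a c, TT a c ∈ K) (w : VV) (hw : w ≠ 0) : ∃ k ∈ K, k • e1 = w := by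
  obtain ⟨a, b, c, d, rfl⟩ := vv4_surj w
  have key : ∀ a b c d : ZMod 3, ¬ (a = 0 ∧ b = 0 ∧ c = 0 ∧ d = 0) → ∃ x y z t : ZMod 3,
      0 * x + 0 * y - 1 * z - 0 * t ≠ 0 ∧ z * a + t * b - x * c - y * d ≠ 0 := by decide
  have hw' : ¬ (a = 0 ∧ b = 0 ∧ c = 0 ∧ d = 0) := by
    rwa [← vv4_inj, vv4_zero]
  obtain ⟨x, y, z, t, h1, h2⟩ := key a b c d hw'
  obtain ⟨k, hk, h, -⟩ := move2 K hK e1 (vv4 a b c d) (vv4 x y z t)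
    (by rwa [e1, om_vv4]) (by rwa [om_vv4])
  exact ⟨k, hk, h⟩

lemma trans2 (K : Subgroup Sp4F3) (hK : ∀ a c, TT a c ∈ K) (w : VV) (hw : om e1 w = om e1 f1) : ∃ k ∈ K, k • f1 = w ∧ k • e1 = e1 := by
  obtain ⟨a, b, c, d, rfl⟩ := vv4_surj w
  have key : ∀ a b d : ZMod 3, ∃ x y t : ZMod 3,
      1 * x + 0 * y - 0 * 1 - 0 * t ≠ 0 ∧ 1 * a + t * b - x * 1 - y * d ≠ 0 := by decide
  have hc : c = 1 := by simpa [e1, f1, om_vv4] using hw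
  subst hc
  obtain ⟨x, y, t, h1, h2⟩ := key a b d
  obtain ⟨k, hk, h, h'⟩ := move2 K hK f1 (vv4 a b 1 d) (vv4 x y 1 t)
    (by rwa [f1, om_vv4]) (by rwa [om_vv4])
  exact ⟨k, hk, h, h' _ (by simp [e1, f1, om_vv4]) (by simp [e1, om_vv4])⟩

lemma trans3 (K : Subgroup Sp4F3) (hK : ∀ a c, TT a c ∈ K) (w : VV) (hw : w ≠ 0) (hw1 : om e1 w = 0) (hw2 : om f1 w = 0) :
    ∃ k ∈ K, k • e2 = w ∧ k • e1 = e1 ∧ k • f1 = f1 := by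
  obtain ⟨a, b, c, d, rfl⟩ := vv4_surj w
  have key : ∀ b d : ZMod 3, ¬ (b = 0 ∧ d = 0) → ∃ y t : ZMod 3,
      0 * 0 + 0 * y - 0 * 0 - 1 * t ≠ 0 ∧ 0 * 0 + t * b - 0 * 0 - y * d ≠ 0 := by decide
  have hc : c = 0 := by simpa [e1, om_vv4] using hw1
  have ha : a = 0 := by simpa [f1, om_vv4] using hw2
  subst hc ha
  have hw' : ¬ (b = 0 ∧ d = 0) := by
    rintro ⟨rfl, rfl⟩; exact hw vv4_zero
  obtain ⟨y, t, h1, h2⟩ := key b d hw'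
  obtain ⟨k, hk, h, h'⟩ := move2 K hK e2 (vv4 0 b 0 d) (vv4 0 y 0 t)
    (by rwa [e2, om_vv4]) (by rwa [om_vv4])
  exact ⟨k, hk, h, h' _ (by simp [e1, e2, om_vv4]) (by simp [e1, om_vv4]),
    h' _ (by simp [f1, e2, om_vv4]) (by simp [f1, om_vv4])⟩

lemma trans4 (K : Subgroup Sp4F3) (hK : ∀ a c, TT a c ∈ K) (w : VV) (hw1 : om e1 w = 0) (hw2 : om f1 w = 0) (hw3 : om e2 w = om e2 f2) :
    ∃ k ∈ K, k • f2 = w ∧ k • e1 = e1 ∧ k • f1 = f1 ∧ k • e2 = e2 := by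
  obtain ⟨a, b, c, d, rfl⟩ := vv4_surj w
  have key : ∀ b : ZMod 3, ∃ y : ZMod 3,
      0 * 0 + 1 * y - 0 * 0 - 0 * 1 ≠ 0 ∧ 0 * 0 + 1 * b - 0 * 0 - y * 1 ≠ 0 := by decide
  have hc : c = 0 := by simpa [e1, om_vv4] using hw1
  have ha : a = 0 := by simpa [f1, om_vv4] using hw2
  have hd : d = 1 := by simpa [e2, f2, om_vv4] using hw3
  subst hc ha hd
  obtain ⟨y, h1, h2⟩ := key b
  obtain ⟨k, hk, h, h'⟩ := move2 K hK f2 (vv4 0 b 0 1) (vv4 0 y 0 1)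
    (by rwa [f2, om_vv4]) (by rwa [om_vv4])
  exact ⟨k, hk, h, h' _ (by simp [e1, f2, om_vv4]) (by simp [e1, om_vv4]),
    h' _ (by simp [f1, f2, om_vv4]) (by simp [f1, om_vv4]),
    h' _ (by simp [e2, f2, om_vv4]) (by simp [e2, om_vv4])⟩

lemma ext4 (g : Sp4F3) (h1 : g • e1 = e1) (h2 : g • f1 = f1) (h3 : g • e2 = e2)
    (h4 : g • f2 = f2) : g = 1 := by
  apply g_ext
  intro v
  obtain ⟨a, b, c, d, rfl⟩ := vv4_surj v
  have : vv4 a b c d = a • e1 + b • e2 + c • f1 + d • f2 := by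
    ext i; rcases i with i | i <;> fin_cases i <;> simp [vv4, e1, e2, f1, f2]
  rw [this, one_smul]
  simp only [g_add, g_smul, h1, h2, h3, h4]

lemma g_zero (g : Sp4F3) : g • (0 : VV) = 0 := by
  simp only [smul_def', Matrix.mulVec_zero]

lemma gen_top (K : Subgroup Sp4F3) (hK : ∀ a c, TT a c ∈ K) : K = ⊤ := by
  rw [eq_top_iff]
  rintro g -
  have ne : ∀ (g : Sp4F3) (v : VV), v ≠ 0 → g • v ≠ 0 := by
    intro g v hv h
    apply hv
    rw [← inv_smul_smul g v, h, g_zero]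
  have e1ne : e1 ≠ 0 := fun h => by simpa [e1, vv4] using congrFun h (Sum.inl 0)
  have e2ne : e2 ≠ 0 := fun h => by simpa [e2, vv4] using congrFun h (Sum.inl 1)
  obtain ⟨k1, m1, h1⟩ := trans1 K hK (g • e1) (ne _ _ e1ne)
  have a1 : (k1⁻¹ * g) • e1 = e1 := by rw [mul_smul, ← h1, inv_smul_smul]
  generalize hg1 : k1⁻¹ * g = g1 at a1
  obtain ⟨k2, m2, h2, h2'⟩ := trans2 K hK (g1 • f1) (by
    conv_lhs => rw [← a1]
    rw [om_inv])
  have b1 : (k2⁻¹ * g1) • e1 = e1 := by rw [mul_smul, a1, inv_smul_eq_iff, h2']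
  have b2 : (k2⁻¹ * g1) • f1 = f1 := by rw [mul_smul, ← h2, inv_smul_smul]
  generalize hg2 : k2⁻¹ * g1 = g2 at b1 b2
  obtain ⟨k3, m3, h3, h3', h3''⟩ := trans3 K hK (g2 • e2) (ne _ _ e2ne) (by
    conv_lhs => rw [← b1]
    rw [om_inv]; simp [e1, e2, om_vv4]) (by
    conv_lhs => rw [← b2]
    rw [om_inv]; simp [f1, e2, om_vv4])
  have c1 : (k3⁻¹ * g2) • e1 = e1 := by rw [mul_smul, b1, inv_smul_eq_iff, h3']
  have c2 : (k3⁻¹ * g2) • f1 = f1 := by rw [mul_smul, b2, inv_smul_eq_iff, h3'']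
  have c3 : (k3⁻¹ * g2) • e2 = e2 := by rw [mul_smul, ← h3, inv_smul_smul]
  generalize hg3 : k3⁻¹ * g2 = g3 at c1 c2 c3
  obtain ⟨k4, m4, h4, h4', h4'', h4'''⟩ := trans4 K hK (g3 • f2) (by
    conv_lhs => rw [← c1]
    rw [om_inv]; simp [e1, f2, om_vv4]) (by
    conv_lhs => rw [← c2]
    rw [om_inv]; simp [f1, f2, om_vv4]) (by
    conv_lhs => rw [← c3]
    rw [om_inv])
  have d1 : (k4⁻¹ * g3) • e1 = e1 := by rw [mul_smul, c1, inv_smul_eq_iff, h4']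
  have d2 : (k4⁻¹ * g3) • f1 = f1 := by rw [mul_smul, c2, inv_smul_eq_iff, h4'']
  have d3 : (k4⁻¹ * g3) • e2 = e2 := by rw [mul_smul, c3, inv_smul_eq_iff, h4''']
  have d4 : (k4⁻¹ * g3) • f2 = f2 := by rw [mul_smul, ← h4, inv_smul_smul]
  have E := ext4 _ d1 d2 d3 d4
  have : g = k1 * (k2 * (k3 * k4)) := by
    rw [inv_mul_eq_one] at E
    rw [E, ← hg3, mul_inv_cancel_left, ← hg2, mul_inv_cancel_left, ← hg1, mul_inv_cancel_left]
  rw [this]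
  exact K.mul_mem m1 (K.mul_mem m2 (K.mul_mem m3 m4))

lemma normal_top (H : Subgroup Sp4F3) (h : ∀ g : Sp4F3, g * TT e1 1 * g⁻¹ ∈ H) : H = ⊤ := by
  apply gen_top
  have h1 : ∀ a, TT a 1 ∈ H := by
    intro a
    by_cases ha : a = 0
    · rw [ha, TT_zero]; exact H.one_mem
    · obtain ⟨k, -, hk⟩ := trans1 ⊤ (fun _ _ => trivial) a ha
      rw [← hk, ← TT_conj]; exact h k
  intro a c
  have : c = 0 ∨ c = 1 ∨ c = 1 + 1 := by revert c; decide
  rcases this with rfl | rfl | rfl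
  · rw [TT_c_zero]; exact H.one_mem
  · exact h1 a
  · rw [← TT_mul]; exact H.mul_mem (h1 a) (h1 a)

/-! The extraspecial group -/
def QM (a b c : ZMod 3) : Matrix (Fin 2 ⊕ Fin 2) (Fin 2 ⊕ Fin 2) (ZMod 3) :=
  fromBlocks !![1, -b; 0, 1] !![c, a; a, 0] 0 !![1, 0; b, 1]

def SM (α β γ δ : ZMod 3) : Matrix (Fin 2 ⊕ Fin 2) (Fin 2 ⊕ Fin 2) (ZMod 3) :=
  fromBlocks !![1, 0; 0, α] !![0, 0; 0, β] !![0, 0; 0, γ] !![1, 0; 0, δ]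

lemma QM_mulVec (a b c x y z t : ZMod 3) : QM a b c *ᵥ vv4 x y z t =
    vv4 (x - b * y + c * z + a * t) (y + a * z) z (b * z + t) := by
  ext i; rcases i with i | i <;> fin_cases i <;>
    simp [QM, vv4, mulVec, dotProduct, Fin.sum_univ_two] <;> ring

lemma SM_mulVec (α β γ δ x y z t : ZMod 3) : SM α β γ δ *ᵥ vv4 x y z t =
    vv4 x (α * y + β * t) z (γ * y + δ * t) := by
  ext i; rcases i with i | i <;> fin_cases i <;>
    simp [SM, vv4, mulVec, dotProduct, Fin.sum_univ_two]

def QQ (a b c : ZMod 3) : Sp4F3 := ⟨QM a b c, mem_of_pres _ fun u v => by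
  obtain ⟨x, y, z, t, rfl⟩ := vv4_surj u
  obtain ⟨x', y', z', t', rfl⟩ := vv4_surj v
  simp only [QM_mulVec, om_vv4]; ring⟩

def SS (α β γ δ : ZMod 3) (h : α * δ - β * γ = 1) : Sp4F3 :=
  ⟨SM α β γ δ, mem_of_pres _ fun u v => by
    obtain ⟨x, y, z, t, rfl⟩ := vv4_surj u
    obtain ⟨x', y', z', t', rfl⟩ := vv4_surj v
    simp only [SM_mulVec, om_vv4]
    linear_combination (t * y' - y * t') * h⟩

lemma QQ_smul (a b c x y z t : ZMod 3) : QQ a b c • vv4 x y z t =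
    vv4 (x - b * y + c * z + a * t) (y + a * z) z (b * z + t) := QM_mulVec ..

lemma SS_smul (α β γ δ x y z t : ZMod 3) (h : α * δ - β * γ = 1) : SS α β γ δ h • vv4 x y z t =
    vv4 x (α * y + β * t) z (γ * y + δ * t) := SM_mulVec ..

lemma QQ_mul (a b c a' b' c' : ZMod 3) : QQ a b c * QQ a' b' c' =
    QQ (a + a') (b + b') (c + c' + (a * b' - a' * b)) := by
  apply g_ext; intro v
  obtain ⟨x, y, z, t, rfl⟩ := vv4_surj v
  rw [mul_smul]
  simp only [QQ_smul, vv4_inj]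
  refine ⟨?_, ?_, trivial, ?_⟩ <;> ring

lemma QQ_zero : QQ 0 0 0 = 1 := by
  apply g_ext; intro v
  obtain ⟨x, y, z, t, rfl⟩ := vv4_surj v
  simp [QQ_smul, vv4_inj]

lemma QQ_inv (a b c : ZMod 3) : (QQ a b c)⁻¹ = QQ (-a) (-b) (-c) := by
  rw [inv_eq_iff_mul_eq_one, QQ_mul, ← QQ_zero]
  congr 1 <;> ring

lemma SS_QQ (α β γ δ a b c : ZMod 3) (h : α * δ - β * γ = 1) :
    SS α β γ δ h * QQ a b c = QQ (α * a + β * b) (γ * a + δ * b) c * SS α β γ δ h := by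
  apply g_ext; intro v
  obtain ⟨x, y, z, t, rfl⟩ := vv4_surj v
  rw [mul_smul, mul_smul]
  simp only [QQ_smul, SM_mulVec, smul_def', SS, QQ, QM_mulVec, vv4_inj]
  refine ⟨?_, ?_, trivial, ?_⟩
  · linear_combination (b * y - a * t) * h
  all_goals ring

lemma QQ_t : QQ 0 0 1 = TT e1 1 := by
  apply g_ext; intro v
  obtain ⟨x, y, z, t, rfl⟩ := vv4_surj v
  rw [QQ_smul, TT_smul, e1, om_vv4]
  ext i; rcases i with i | i <;> fin_cases i <;> simp [vv4]

section act
variable {X : Type*} [MulAction Sp4F3 X]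

lemma stab_center (x : X) (hx : QQ 0 0 1 • x ≠ x) (c : ZMod 3) (h : QQ 0 0 c • x = x) : c = 0 := by
  have : c = 0 ∨ c = 1 ∨ c = 2 := by clear h; revert c; decide
  rcases this with rfl | rfl | rfl
  · rfl
  · exact absurd h hx
  · exfalso; apply hx
    have e : QQ 0 0 1 = QQ 0 0 2 * QQ 0 0 2 := by rw [QQ_mul]; congr 1
    rw [e, mul_smul, h, h]

lemma stab_comm (x : X) (hx : QQ 0 0 1 • x ≠ x) (a b c a' b' c' : ZMod 3)
    (h : QQ a b c • x = x) (h' : QQ a' b' c' • x = x) : a * b' - a' * b = 0 := by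
  have e : QQ a b c * QQ a' b' c' = QQ 0 0 (2 * (a * b' - a' * b)) * (QQ a' b' c' * QQ a b c) := by
    simp only [QQ_mul]; congr 1 <;> ring
  have := congrArg (· • x) e
  simp only [mul_smul, h, h'] at this
  have h2 := stab_center x hx _ this.symm
  revert h2; generalize a * b' - a' * b = u; revert u; decide

lemma move_eq (x : X) (a b c a' b' c' : ZMod 3) (h : QQ a b c • x = QQ a' b' c' • x) :
    QQ (a - a') (b - b') (c - c' + (a * b' - a' * b)) • x = x := by
  have e : QQ (a - a') (b - b') (c - c' + (a * b' - a' * b)) = (QQ a' b' c')⁻¹ * QQ a b c := by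
    rw [QQ_inv, QQ_mul]; congr 1 <;> ring
  rw [e, mul_smul, h, inv_smul_smul]

lemma center_comm (a b c : ZMod 3) : QQ 0 0 1 * QQ a b c = QQ a b c * QQ 0 0 1 := by
  simp only [QQ_mul]; congr 1 <;> ring

def vL : Fin 4 → ZMod 3 × ZMod 3 := ![(1, 0), (0, 1), (1, 1), (1, 2)]
def wL : Fin 4 → ZMod 3 × ZMod 3 := ![(0, 1), (1, 0), (0, 1), (0, 1)]

lemma big [Finite X] (x : X) (hx : QQ 0 0 1 • x ≠ x) : 27 ≤ Nat.card X := by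
  by_cases hq : ∃ a b c, QQ a b c • x = x ∧ ¬ (a = 0 ∧ b = 0 ∧ c = 0)
  · obtain ⟨a, b, c, hs, hne⟩ := hq
    have hab : ¬ (a = 0 ∧ b = 0) := by
      rintro ⟨rfl, rfl⟩
      exact hne ⟨rfl, rfl, stab_center x hx c hs⟩
    have hex : ∀ i : Fin 4, ∃ y : X, QQ 0 0 1 • y ≠ y ∧ QQ (vL i).1 (vL i).2 c • y = y := by
      intro i
      have key : ∀ a b : ZMod 3, ¬ (a = 0 ∧ b = 0) → ∀ i : Fin 4, ∃ α β γ δ : ZMod 3,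
          α * δ - β * γ = 1 ∧ α * a + β * b = (vL i).1 ∧ γ * a + δ * b = (vL i).2 := by decide
      obtain ⟨α, β, γ, δ, h, h1, h2⟩ := key a b hab i
      refine ⟨SS α β γ δ h • x, ?_, ?_⟩
      · intro h'
        have e := SS_QQ α β γ δ 0 0 1 h
        simp only [mul_zero, add_zero] at e
        rw [← mul_smul, ← e, mul_smul] at h'
        exact hx (MulAction.injective _ h')
      · rw [← h1, ← h2, ← mul_smul, ← SS_QQ, mul_smul, hs]
    choose y hy1 hy2 using hex
    let F : Fin 4 × ZMod 3 × ZMod 3 → X := fun p =>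
      QQ (p.2.1 * (wL p.1).1) (p.2.1 * (wL p.1).2) p.2.2 • y p.1
    have hF : Function.Injective F := by
      rintro ⟨i, b, c'⟩ ⟨j, b', c''⟩ hij
      simp only [F] at hij
      have st : ∀ (i : Fin 4) (b d : ZMod 3), ∃ k,
          QQ (vL i).1 (vL i).2 k • (QQ (b * (wL i).1) (b * (wL i).2) d • y i)
            = QQ (b * (wL i).1) (b * (wL i).2) d • y i := by
        intro i b d
        refine ⟨c - 2 * ((vL i).1 * (b * (wL i).2) - b * (wL i).1 * (vL i).2), ?_⟩
        conv_rhs => rw [← hy2 i]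
        rw [← mul_smul, ← mul_smul, QQ_mul, QQ_mul]
        congr 2 <;> ring
      obtain ⟨k, hk⟩ := st i b c'
      obtain ⟨k', hk'⟩ := st j b' c''
      rw [← hij] at hk'
      have mv : QQ 0 0 1 • (QQ (b * (wL i).1) (b * (wL i).2) c' • y i) ≠
          QQ (b * (wL i).1) (b * (wL i).2) c' • y i := by
        rw [← mul_smul, center_comm, mul_smul]
        exact fun h => hy1 i (MulAction.injective _ h)
      have hd := stab_comm _ mv _ _ _ _ _ _ hk hk'
      have hijeq : i = j := by
        revert hd; clear * -; revert i j; decide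
      subst hijeq
      have h3 := move_eq _ _ _ _ _ _ _ hij
      have h4 := stab_comm _ (hy1 i) _ _ _ _ _ _ (hy2 i) h3
      have hb : b = b' := by
        revert h4; clear * -; revert i b b'; decide
      subst hb
      simp only [sub_self, add_zero] at h3
      have h5 := stab_center _ (hy1 i) _ h3
      rw [sub_eq_zero] at h5
      rw [h5]
    have := Nat.card_le_card_of_injective F hF
    simp at this
    omega
  · push Not at hq
    let F : ZMod 3 × ZMod 3 × ZMod 3 → X := fun p => QQ p.1 p.2.1 p.2.2 • x
    have hF : Function.Injective F := by
      rintro ⟨a, b, c⟩ ⟨a', b', c'⟩ h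
      obtain ⟨h1, h2, h3⟩ := hq _ _ _ (move_eq _ _ _ _ _ _ _ h)
      rw [sub_eq_zero] at h1 h2
      subst h1 h2
      simp only [sub_self, add_zero] at h3
      rw [sub_eq_zero] at h3
      rw [h3]
    have := Nat.card_le_card_of_injective F hF
    simpa using this
end act

instance : Finite Sp4F3 := Subtype.finite

lemma Sp_index (H : Subgroup Sp4F3) (hH : H ≠ ⊤) : 27 ≤ H.index := by
  by_contra hlt
  apply hH
  apply normal_top
  intro g
  by_contra hg
  apply hlt
  apply big (X := Sp4F3 ⧸ H) ((g⁻¹ : Sp4F3) : Sp4F3 ⧸ H)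
  intro h
  apply hg
  rw [QQ_t] at h
  have h' := QuotientGroup.eq.1 (h.symm : ((g⁻¹ : Sp4F3) : Sp4F3 ⧸ H) = ((TT e1 1 * g⁻¹ : Sp4F3) : Sp4F3 ⧸ H))
  rw [inv_inv] at h'
  rw [mul_assoc]
  exact h'

lemma card_step (S : Subgroup Sp4F3) (v : VV) : Nat.card S =
    (MulAction.orbit S v).ncard * Nat.card (S ⊓ MulAction.stabilizer Sp4F3 v : Subgroup Sp4F3) := by
  rw [← MulAction.index_stabilizer, ← Subgroup.card_mul_index (MulAction.stabilizer S v), mul_comm]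
  congr 1
  refine Nat.card_congr ⟨fun x => ⟨x.1.1, x.1.2, x.2⟩, fun x => ⟨⟨x.1, x.2.1⟩, x.2.2⟩,
    fun _ => rfl, fun _ => rfl⟩

lemma ncard_range {ι : Type*} (s : Set VV) (F : ι → VV) (hF : Function.Injective F)
    (h : ∀ v, v ∈ s ↔ ∃ i, F i = v) : s.ncard = Nat.card ι := by
  have : s = Set.range F := by ext v; exact h v
  rw [this, ← Set.image_univ, Set.ncard_image_of_injective _ hF, Set.ncard_univ]

lemma ne_zero_smul (g : Sp4F3) (v : VV) (hv : v ≠ 0) : g • v ≠ 0 := by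
  intro h
  apply hv
  rw [← inv_smul_smul g v, h, g_zero]

lemma e1ne : e1 ≠ 0 := fun h => by simpa [e1, vv4] using congrFun h (Sum.inl 0)
lemma e2ne : e2 ≠ 0 := fun h => by simpa [e2, vv4] using congrFun h (Sum.inl 1)

lemma om_fix (g : Sp4F3) (u v : VV) (h : g • u = u) : om u (g • v) = om u v := by
  conv_lhs => rw [← h]
  rw [om_inv]

lemma card_Sp : Nat.card Sp4F3 = 51840 := by
  have tt : ∀ a c, TT a c ∈ (⊤ : Subgroup Sp4F3) := fun _ _ => trivial
  rw [← Subgroup.card_top, card_step ⊤ e1, card_step _ f1, card_step _ e2, card_step _ f2]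
  have o1 : (MulAction.orbit (⊤ : Subgroup Sp4F3) e1).ncard = 80 := by
    have : MulAction.orbit (⊤ : Subgroup Sp4F3) e1 = {0}ᶜ := by
      ext v
      constructor
      · rintro ⟨⟨g, hg⟩, rfl⟩
        exact ne_zero_smul g _ e1ne
      · intro hv
        obtain ⟨k, -, hk⟩ := trans1 ⊤ tt v hv
        exact ⟨⟨k, trivial⟩, hk⟩
    rw [this, Set.ncard_compl, Set.ncard_singleton]
    simp
  have o2 : (MulAction.orbit (⊤ ⊓ MulAction.stabilizer Sp4F3 e1 : Subgroup Sp4F3) f1).ncard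
      = 27 := by
    rw [ncard_range (ι := ZMod 3 × ZMod 3 × ZMod 3) _ (fun p => vv4 p.1 p.2.1 1 p.2.2)]
    · simp
    · rintro ⟨a, b, c⟩ ⟨a', b', c'⟩ h
      simpa [vv4_inj] using h
    · intro v
      constructor
      · rintro ⟨⟨g, -, hg⟩, rfl⟩
        have := om_fix g e1 f1 hg
        obtain ⟨a, b, c, d, h⟩ := vv4_surj (g • f1)
        rw [h] at this
        have hc : c = 1 := by simpa [e1, f1, om_vv4] using this
        exact ⟨(a, b, d), by subst hc; exact h.symm⟩
      · rintro ⟨p, rfl⟩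
        obtain ⟨k, -, hk, hk'⟩ := trans2 ⊤ tt (vv4 p.1 p.2.1 1 p.2.2) (by simp [e1, f1, om_vv4])
        exact ⟨⟨k, trivial, hk'⟩, hk⟩
  have o3 : (MulAction.orbit (⊤ ⊓ MulAction.stabilizer Sp4F3 e1 ⊓ MulAction.stabilizer Sp4F3 f1 :
      Subgroup Sp4F3) e2).ncard = 8 := by
    rw [ncard_range (ι := {p : ZMod 3 × ZMod 3 // p ≠ 0}) _ (fun p => vv4 0 p.1.1 0 p.1.2)]
    · rw [Nat.card_eq_fintype_card]; decide
    · rintro ⟨⟨a, b⟩, _⟩ ⟨⟨a', b'⟩, _⟩ h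
      simpa [vv4_inj] using h
    · intro v
      constructor
      · rintro ⟨⟨g, ⟨-, hg⟩, hg'⟩, rfl⟩
        have h1 := om_fix g e1 e2 hg
        have h2 := om_fix g f1 e2 hg'
        have h0 := ne_zero_smul g _ e2ne
        obtain ⟨a, b, c, d, h⟩ := vv4_surj (g • e2)
        rw [h] at h1 h2 h0
        have hc : c = 0 := by simpa [e1, e2, om_vv4] using h1
        have ha : a = 0 := by simpa [f1, e2, om_vv4] using h2
        subst hc ha
        refine ⟨⟨(b, d), ?_⟩, h.symm⟩
        intro hbd
        rw [Prod.mk_eq_zero] at hbd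
        rw [hbd.1, hbd.2] at h0
        exact h0 vv4_zero
      · rintro ⟨⟨⟨b, d⟩, hp⟩, rfl⟩
        obtain ⟨k, -, hk, hk', hk''⟩ := trans3 ⊤ tt (vv4 0 b 0 d) (by
          rw [← vv4_zero, Ne, vv4_inj]
          simpa using hp) (by simp [e1, om_vv4]) (by simp [f1, om_vv4])
        exact ⟨⟨k, ⟨trivial, hk'⟩, hk''⟩, hk⟩
  have o4 : (MulAction.orbit (⊤ ⊓ MulAction.stabilizer Sp4F3 e1 ⊓ MulAction.stabilizer Sp4F3 f1
      ⊓ MulAction.stabilizer Sp4F3 e2 : Subgroup Sp4F3) f2).ncard = 3 := by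
    rw [ncard_range (ι := ZMod 3) _ (fun p => vv4 0 p 0 1)]
    · simp
    · intro a b h
      simpa [vv4_inj] using h
    · intro v
      constructor
      · rintro ⟨⟨g, ⟨⟨-, hg⟩, hg'⟩, hg''⟩, rfl⟩
        have h1 := om_fix g e1 f2 hg
        have h2 := om_fix g f1 f2 hg'
        have h3 := om_fix g e2 f2 hg''
        obtain ⟨a, b, c, d, h⟩ := vv4_surj (g • f2)
        rw [h] at h1 h2 h3
        have hc : c = 0 := by simpa [e1, f2, om_vv4] using h1
        have ha : a = 0 := by simpa [f1, f2, om_vv4] using h2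
        have hd : d = 1 := by simpa [e2, f2, om_vv4] using h3
        subst hc ha hd
        exact ⟨b, h.symm⟩
      · rintro ⟨b, rfl⟩
        obtain ⟨k, -, hk, hk', hk'', hk3⟩ := trans4 ⊤ tt (vv4 0 b 0 1) (by simp [e1, om_vv4])
          (by simp [f1, om_vv4]) (by simp [e2, f2, om_vv4])
        exact ⟨⟨k, ⟨⟨trivial, hk'⟩, hk''⟩, hk3⟩, hk⟩
  have o5 : (⊤ ⊓ MulAction.stabilizer Sp4F3 e1 ⊓ MulAction.stabilizer Sp4F3 f1
      ⊓ MulAction.stabilizer Sp4F3 e2 ⊓ MulAction.stabilizer Sp4F3 f2 : Subgroup Sp4F3) = ⊥ := by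
    rw [eq_bot_iff]
    rintro g ⟨⟨⟨⟨-, h1⟩, h2⟩, h3⟩, h4⟩
    exact ext4 g h1 h2 h3 h4
  rw [o1, o2, o3, o4, o5, Subgroup.card_bot]

lemma central_eig (g : Sp4F3) (hg : g ∈ Subgroup.center Sp4F3) (a x : VV) :
    om (g • x) a • a = om x a • (g • a) := by
  have h := Subgroup.mem_center_iff.1 hg (TT a 1)
  have h2 := congrArg (· • x) h
  simp only [mul_smul, TT_smul, g_add, one_mul, g_smul] at h2
  exact add_left_cancel h2

def negOne : Sp4F3 := ⟨-1, SymplecticGroup.neg_mem (one_mem _)⟩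

lemma negOne_smul (v : VV) : negOne • v = -v := by
  rw [smul_def', negOne]; simp [Matrix.neg_mulVec]

lemma central_scalar (g : Sp4F3) (hg : g ∈ Subgroup.center Sp4F3) : ∃ k : ZMod 3, ∀ v : VV,
    g • v = k • v := by
  have hl : ∀ a : VV, a ≠ 0 → ∃ k : ZMod 3, g • a = k • a := by
    intro a ha
    have : ∃ x, om x a = 1 := by
      obtain ⟨k, -, hk⟩ := trans1 ⊤ (fun _ _ => trivial) a ha
      refine ⟨k • f1, ?_⟩
      rw [← hk, om_inv]; simp [e1, f1, om_vv4]
    obtain ⟨x, hx⟩ := this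
    exact ⟨_, by rw [central_eig g hg a x, hx, one_smul]⟩
  obtain ⟨k, hk⟩ := hl e1 e1ne
  obtain ⟨l, hl1⟩ := hl (vv4 1 1 1 1) (by rw [← vv4_zero, Ne, vv4_inj]; simp)
  obtain ⟨k2, hk2⟩ := hl e2 e2ne
  obtain ⟨k3, hk3⟩ := hl f1 (by rw [f1, ← vv4_zero, Ne, vv4_inj]; simp)
  obtain ⟨k4, hk4⟩ := hl f2 (by rw [f2, ← vv4_zero, Ne, vv4_inj]; simp)
  have dec : ∀ a b c d, vv4 a b c d = a • e1 + b • e2 + c • f1 + d • f2 := by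
    intro a b c d
    ext i; rcases i with i | i <;> fin_cases i <;> simp [vv4, e1, e2, f1, f2]
  have act : ∀ a b c d, g • vv4 a b c d = vv4 (a * k) (b * k2) (c * k3) (d * k4) := by
    intro a b c d
    rw [dec, dec]
    simp only [g_add, g_smul, hk, hk2, hk3, hk4, smul_smul]
  have sm : ∀ l a b c d : ZMod 3, l • vv4 a b c d = vv4 (l * a) (l * b) (l * c) (l * d) := by
    intro l a b c d
    ext i; rcases i with i | i <;> fin_cases i <;> simp [vv4]
  rw [act, sm, vv4_inj] at hl1
  simp only [one_mul, mul_one] at hl1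
  obtain ⟨rfl, rfl, rfl, rfl⟩ := hl1
  refine ⟨k4, fun v => ?_⟩
  obtain ⟨a, b, c, d, rfl⟩ := vv4_surj v
  rw [act, sm]
  simp only [mul_comm]

lemma center_eq : (Subgroup.center Sp4F3 : Set Sp4F3) = {1, negOne} := by
  ext g
  constructor
  · intro hg
    obtain ⟨k, hk⟩ := central_scalar g hg
    have : k = 0 ∨ k = 1 ∨ k = -1 := by clear hk; revert k; decide
    rcases this with rfl | rfl | rfl
    · exact absurd ((hk e1).trans (zero_smul _ _)) (ne_zero_smul g _ e1ne)
    · left; apply g_ext; intro v; rw [hk, one_smul, one_smul]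
    · right; apply g_ext; intro v; rw [hk, negOne_smul, neg_one_smul]
  · rintro (rfl | rfl)
    · exact one_mem _
    · refine Subgroup.mem_center_iff.2 fun g => g_ext _ _ fun v => ?_
      rw [mul_smul, mul_smul, negOne_smul, negOne_smul]
      simp only [smul_def', Matrix.mulVec_neg]

lemma card_center : Nat.card (Subgroup.center Sp4F3) = 2 := by
  have h : Nat.card (Subgroup.center Sp4F3) = (Subgroup.center Sp4F3 : Set Sp4F3).ncard := rfl
  rw [h, center_eq, Set.ncard_pair]
  intro h
  have h2 := congrArg (· • e1) h
  simp only [one_smul, negOne_smul] at h2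
  have h3 := congrFun h2 (Sum.inl 0)
  revert h3
  simp only [e1, vv4, Pi.neg_apply]
  decide

lemma card_PSp : Nat.card PSp4F3 = 25920 := by
  have h := Subgroup.card_mul_index (Subgroup.center Sp4F3)
  rw [card_center, card_Sp] at h
  change (Subgroup.center Sp4F3).index = _
  omega

lemma PSp_index (H : Subgroup PSp4F3) (hH : H ≠ ⊤) : 27 ≤ H.index := by
  rw [← Subgroup.index_comap_of_surjective H (QuotientGroup.mk'_surjective (Subgroup.center Sp4F3))]
  apply Sp_index
  intro h
  apply hH
  rw [← Subgroup.comap_top (QuotientGroup.mk' (Subgroup.center Sp4F3))] at h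
  exact Subgroup.comap_injective (QuotientGroup.mk'_surjective _) h

end work

/-- Every proper subgroup of the simple group `PSp₄(F₃)` has index at least `27`; in particular
`PSp₄(F₃)` (of order `25920`) has no proper subgroup of index between `2` and `26`. -/
theorem PSp4F3_min_index_of_proper_subgroup :
    (∀ H : Subgroup PSp4F3, H ≠ ⊤ → 27 ≤ H.index) ∧
    Nat.card PSp4F3 = 25920 ∧
    (∀ H : Subgroup PSp4F3, H ≠ ⊤ → ¬ (2 ≤ H.index ∧ H.index ≤ 26)) := by
  exact ⟨PSp_index, card_PSp, fun H hH h => by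
    have := PSp_index H hH
    omega⟩
end

section
/- Let G = 3.A7 with center Z of order 3 and quotient map ν : G → A7. Every proper subgroup of G of index at most 15 contains Z, and up to conjugacy the proper subgroups of index at most 15 are exactly: the preimage ν⁻¹(A6) of a point stabilizer A6 ⊂ A7, which has index 7 and is isomorphic to 3.A6; and the preimage ν⁻¹(PSL2(F7)) of a subgroup PSL2(F7) ⊂ A7, which has index 15 and is isomorphic to the direct product PSL2(F7) × ℤ/3ℤ. -/
/-- The simple group `PSL₂(F₇)` (of order `168`). -/
abbrev PSL2F7 : Type := Matrix.ProjectiveSpecialLinearGroup (Fin 2) (ZMod 7)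

/-- `G` is isomorphic to `3.A₇`: a perfect group whose center is cyclic of order `3` and whose
quotient by the center is the alternating group `A₇`.  Unique up to isomorphism. -/
def IsTripleCoverA7 (G : Type*) [Group G] : Prop :=
  commutator G = ⊤ ∧ IsCyclic (Subgroup.center G) ∧ Nat.card (Subgroup.center G) = 3 ∧
    Nonempty (G ⧸ Subgroup.center G ≃* alternatingGroup (Fin 7))

/-- `G` is isomorphic to `3.A₆`: a perfect group whose center is cyclic of order `3` and whose
quotient by the center is the alternating group `A₆`.  Unique up to isomorphism. -/
def IsTripleCoverA6 (G : Type*) [Group G] : Prop :=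
  commutator G = ⊤ ∧ IsCyclic (Subgroup.center G) ∧ Nat.card (Subgroup.center G) = 3 ∧
    Nonempty (G ⧸ Subgroup.center G ≃* alternatingGroup (Fin 6))

/-- The 7-cycle `i ↦ i + 1`. -/
def rot7 : Equiv.Perm (Fin 7) where
  toFun i := i + 1
  invFun i := i + 6
  left_inv := by decide
  right_inv := by decide

/-- The involution `(1 2)(3 6)`. -/
def invo7 : Equiv.Perm (Fin 7) where
  toFun i := ![0, 2, 1, 6, 4, 5, 3] i
  invFun i := ![0, 2, 1, 6, 4, 5, 3] i
  left_inv := by decide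
  right_inv := by decide

/-- Negation. -/
def neg7 : Equiv.Perm (Fin 7) where
  toFun i := - i
  invFun i := - i
  left_inv := by decide
  right_inv := by decide

def word7 (t : Equiv.Perm (Fin 7)) (w : ℕ × ℕ × ℕ) : Equiv.Perm (Fin 7) :=
  (t * rot7 ^ w.1 * t * rot7 ^ w.2.1) ^ w.2.2

def words7 : List (ℕ × ℕ × ℕ) :=
  [(1,1,1), (2,2,1), (3,3,1), (1,3,2), (1,5,2), (1,3,1)]

def good7 (q : Equiv.Perm (Fin 7)) : Prop :=
  q.support.card = 3 ∨ (∃ k : Fin 7, rot7 ^ k.val * q * rot7 ^ (7 - k.val) = invo7) ∨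
    ∃ k : Fin 7, rot7 ^ k.val * q * rot7 ^ (7 - k.val) = neg7 * invo7 * neg7

instance : DecidablePred good7 := fun q => by unfold good7; infer_instance

set_option maxRecDepth 100000 in
theorem words_good : ∀ b c d : Fin 7, b ≠ 0 → c ≠ 0 → c ≠ b → d ≠ 0 → d ≠ b → d ≠ c →
    good7 (Equiv.swap 0 b * Equiv.swap c d) ∨
    ∃ w ∈ words7, good7 (word7 (Equiv.swap 0 b * Equiv.swap c d) w) := by
  decide +kernel
abbrev SL27 : Type := Matrix.SpecialLinearGroup (Fin 2) (ZMod 7)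

def tabs (i : ZMod 7) : ZMod 7 := invo7 i

def act4 (a b c d i : ZMod 7) : ZMod 7 :=
  if c = 0 then a * a * i + a * b else a * c ^ 5 + tabs (c * c * i + c * d)

def actSL (g : SL27) (i : ZMod 7) : ZMod 7 := act4 (g 0 0) (g 0 1) (g 1 0) (g 1 1) i

def matU : SL27 := ⟨!![1, 1; 0, 1], by simp⟩
def matS : SL27 := ⟨!![0, -1; 1, 0], by simp⟩

theorem det_eq (g : SL27) : g 0 0 * g 1 1 - g 0 1 * g 1 0 = 1 := by
  have := g.det_coe
  rwa [Matrix.det_fin_two] at this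

theorem matU_pow (k : ℕ) : ((matU ^ k : SL27) : Matrix (Fin 2) (Fin 2) (ZMod 7)) = !![1, (k : ZMod 7); 0, 1] := by
  induction k with
  | zero => ext i j; fin_cases i <;> fin_cases j <;> simp
  | succ k ih =>
    rw [pow_succ, Matrix.SpecialLinearGroup.coe_mul, ih]
    ext i j; fin_cases i <;> fin_cases j <;> simp [matU, Matrix.mul_apply, Fin.sum_univ_two, add_comm]

instance : Fact (Nat.Prime 7) := ⟨by norm_num⟩

theorem SL27_gen (M : Submonoid SL27) (hU : matU ∈ M) (hS : matS ∈ M) (g : SL27) : g ∈ M := by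
  have hUx : ∀ x : ZMod 7, ∃ u ∈ M, (u : Matrix (Fin 2) (Fin 2) (ZMod 7)) = !![1, x; 0, 1] := by
    intro x
    refine ⟨matU ^ x.val, M.pow_mem hU _, ?_⟩
    rw [matU_pow]; simp
  have hLx : ∀ x : ZMod 7, ∃ u ∈ M, (u : Matrix (Fin 2) (Fin 2) (ZMod 7)) = !![1, 0; x, 1] := by
    intro x
    obtain ⟨u, hu, hu'⟩ := hUx (-x)
    refine ⟨matS * u * matS ^ 3, M.mul_mem (M.mul_mem hS hu) (M.pow_mem hS _), ?_⟩
    rw [Matrix.SpecialLinearGroup.coe_mul, Matrix.SpecialLinearGroup.coe_mul, Matrix.SpecialLinearGroup.coe_pow, hu']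
    ext i j; fin_cases i <;> fin_cases j <;> simp [matS, pow_succ]
  have key : ∀ g : SL27, g 1 0 ≠ 0 → g ∈ M := by
    intro g hc
    obtain ⟨u, hu, hu'⟩ := hUx ((g 0 0 - 1) / g 1 0)
    obtain ⟨v, hv, hv'⟩ := hLx (g 1 0)
    obtain ⟨w, hw, hw'⟩ := hUx ((g 1 1 - 1) / g 1 0)
    have : g = u * v * w := by
      apply Subtype.ext
      have hd := det_eq g
      rw [Matrix.SpecialLinearGroup.coe_mul, Matrix.SpecialLinearGroup.coe_mul, hu', hv', hw']
      ext i j; fin_cases i <;> fin_cases j <;> simp [Matrix.mul_apply, Fin.sum_univ_two] <;> field_simp <;>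
       first | linear_combination hd | linear_combination -hd | ring
    rw [this]; exact M.mul_mem (M.mul_mem hu hv) hw
  by_cases hc : g 1 0 = 0
  · have hd := det_eq g
    have h1 : (matS * g) 1 0 ≠ 0 := by
      have : (matS * g) 1 0 = g 0 0 := by
        rw [Matrix.SpecialLinearGroup.coe_mul]; simp [matS, Matrix.mul_apply, Fin.sum_univ_two]
      rw [this]; intro h0; rw [hc, h0] at hd; simp at hd
    have h2 := key _ h1
    have h3 : matS ^ 3 * (matS * g) = g := by
      rw [← mul_assoc, ← pow_succ]
      have : matS ^ 4 = 1 := by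
        apply Subtype.ext
        rw [Matrix.SpecialLinearGroup.coe_pow]
        ext i j; fin_cases i <;> fin_cases j <;> simp [matS, pow_succ]
      rw [this, one_mul]
    rw [← h3]; exact M.mul_mem (M.pow_mem hS 3) h2
  · exact key g hc

set_option maxRecDepth 100000 in
theorem act4_S : ∀ a b c d i : ZMod 7, a * d - b * c = 1 →
    act4 (-c) (-d) a b i = tabs (act4 a b c d i) := by
  decide +kernel

theorem act4_U (a b c d i : ZMod 7) (h : a * d - b * c = 1) :
    act4 (a + c) (b + d) c d i = act4 a b c d i + 1 := by
  unfold act4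
  split_ifs with hc
  · subst hc; linear_combination h
  · have : c ^ 6 = 1 := ZMod.pow_card_sub_one_eq_one hc
    linear_combination this

theorem actSL_U (g : SL27) (i) : actSL (matU * g) i = actSL g i + 1 := by
  have := act4_U _ _ _ _ i (det_eq g)
  rw [actSL, actSL, ← this, Matrix.SpecialLinearGroup.coe_mul]
  simp [matU, Matrix.mul_apply, Fin.sum_univ_two]

theorem actSL_S (g : SL27) (i) : actSL (matS * g) i = tabs (actSL g i) := by
  have := act4_S _ _ _ _ i (det_eq g)
  rw [actSL, actSL, ← this, Matrix.SpecialLinearGroup.coe_mul]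
  simp [matS, Matrix.mul_apply, Fin.sum_univ_two]

theorem actSL_one (i) : actSL 1 i = i := by
  simp [actSL, act4]

theorem actSL_mul (g h : SL27) (i) : actSL (g * h) i = actSL g (actSL h i) := by
  let M : Submonoid SL27 :=
    { carrier := {g | ∀ h i, actSL (g * h) i = actSL g (actSL h i)}
      one_mem' := by intro h i; rw [one_mul, actSL_one]
      mul_mem' := by
        intro a b ha hb h i
        rw [mul_assoc, ha, hb, ha] }
  have h1 : matU ∈ M := by
    intro h i
    rw [actSL_U]
    have := actSL_U 1 (actSL h i)
    rw [mul_one, actSL_one] at this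
    rw [this]
  have h2 : matS ∈ M := by
    intro h i
    rw [actSL_S]
    have := actSL_S 1 (actSL h i)
    rw [mul_one, actSL_one] at this
    rw [this]
  exact SL27_gen M h1 h2 g h i

/-- The exceptional action of `SL₂(F₇)` on seven points. -/
def homSL : SL27 →* Equiv.Perm (Fin 7) where
  toFun g :=
    { toFun := actSL g
      invFun := actSL g⁻¹
      left_inv := fun i => (actSL_mul g⁻¹ g i).symm.trans ((congrArg (fun x => actSL x i) (inv_mul_cancel g)).trans (actSL_one i))
      right_inv := fun i => (actSL_mul g g⁻¹ i).symm.trans ((congrArg (fun x => actSL x i) (mul_inv_cancel g)).trans (actSL_one i)) }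
  map_one' := Equiv.ext actSL_one
  map_mul' g h := Equiv.ext (actSL_mul g h)

theorem homSL_U : homSL matU = rot7 := by
  have h : ∀ i : ZMod 7, actSL matU i = i + 1 := fun i => by
    have := actSL_U 1 i
    rwa [mul_one, actSL_one] at this
  exact Equiv.ext h

theorem homSL_S : homSL matS = invo7 := by
  have h : ∀ i : ZMod 7, actSL matS i = tabs i := fun i => by
    have := actSL_S 1 i
    rwa [mul_one, actSL_one] at this
  exact Equiv.ext h

theorem homSL_center : Subgroup.center SL27 ≤ homSL.ker := by
  intro g hg
  rw [Matrix.SpecialLinearGroup.mem_center_iff] at hg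
  obtain ⟨r, hr, hg⟩ := hg
  rw [MonoidHom.mem_ker]
  have h : ∀ i : ZMod 7, actSL g i = i := by
    intro i
    rw [actSL, ← hg]
    have : r * r = 1 := by simpa [pow_two] using hr
    simp [act4, this]
  exact Equiv.ext h

noncomputable def homPSL : PSL2F7 →* Equiv.Perm (Fin 7) :=
  QuotientGroup.lift _ homSL homSL_center

theorem homPSL_mk (g : SL27) : homPSL (QuotientGroup.mk g) = homSL g := rfl

instance simplePSL : IsSimpleGroup PSL2F7 :=
  Matrix.ProjectiveSpecialLinearGroup.rank_two_simple (by simp)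

theorem perfectPSL : commutator PSL2F7 = ⊤ :=
  SL2Simple.PSL_commutator_eq_top ⟨2, by decide, by decide⟩

theorem homPSL_inj : Function.Injective homPSL := by
  rw [← MonoidHom.ker_eq_bot_iff]
  rcases (inferInstance : homPSL.ker.Normal).eq_bot_or_eq_top with h | h
  · exact h
  · exfalso
    have : (QuotientGroup.mk matU : PSL2F7) ∈ homPSL.ker := by rw [h]; trivial
    rw [MonoidHom.mem_ker, homPSL_mk, homSL_U] at this
    revert this; decide

theorem homPSL_range_le {K : Subgroup (Equiv.Perm (Fin 7))} (h1 : rot7 ∈ K) (h2 : invo7 ∈ K) :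
    homPSL.range ≤ K := by
  rintro _ ⟨x, rfl⟩
  obtain ⟨g, rfl⟩ := QuotientGroup.mk_surjective x
  rw [homPSL_mk]
  exact SL27_gen (K.comap homSL).toSubmonoid (by simpa [homSL_U]) (by simpa [homSL_S]) g

theorem homPSL_alt : homPSL.range ≤ alternatingGroup (Fin 7) :=
  homPSL_range_le (by rw [Equiv.Perm.mem_alternatingGroup]; decide) (by rw [Equiv.Perm.mem_alternatingGroup]; decide)

set_option maxRecDepth 100000 in
theorem card_quad : Fintype.card {p : ZMod 7 × ZMod 7 × ZMod 7 × ZMod 7 // p.1 * p.2.2.2 - p.2.1 * p.2.2.1 = 1} = 336 := by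
  decide +kernel

theorem card_SL27 : Nat.card SL27 = 336 := by
  rw [← card_quad, ← Nat.card_eq_fintype_card]
  refine Nat.card_congr
    { toFun := fun g => ⟨(g 0 0, g 0 1, g 1 0, g 1 1), det_eq g⟩
      invFun := fun p => ⟨!![p.1.1, p.1.2.1; p.1.2.2.1, p.1.2.2.2], by
        rw [Matrix.det_fin_two_of]; exact p.2⟩
      left_inv := ?_
      right_inv := ?_ }
  · intro g
    ext i j
    fin_cases i <;> fin_cases j <;> simp
  · rintro ⟨⟨a, b, c, d⟩, h⟩
    simp

theorem card_PSL : Nat.card PSL2F7 = 168 := by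
  have h1 := Subgroup.card_eq_card_quotient_mul_card_subgroup (Subgroup.center SL27)
  have h2 : Nat.card (Subgroup.center SL27) = 2 := by
    rw [Nat.card_congr (Matrix.SpecialLinearGroup.center_equiv_rootsOfUnity' (R := ZMod 7) (0 : Fin 2)).toEquiv]
    simp only [Fintype.card_fin]
    have : ∀ u : (ZMod 7)ˣ, u ∈ rootsOfUnity 2 (ZMod 7) ↔ u = 1 ∨ u = -1 := by
      simp only [mem_rootsOfUnity]; decide
    have h3 : ((rootsOfUnity 2 (ZMod 7) : Subgroup (ZMod 7)ˣ) : Set (ZMod 7)ˣ) = {1, -1} := by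
      ext u; simpa using this u
    rw [← SetLike.coe_sort_coe, Nat.card_coe_set_eq, h3, Set.ncard_pair (by decide)]
  rw [card_SL27, h2] at h1
  change 336 = Nat.card PSL2F7 * 2 at h1
  omega
open Equiv Equiv.Perm in
theorem conj_rot7 {g : Perm (Fin 7)} (hg : orderOf g = 7) :
    ∃ σ : Perm (Fin 7), σ * g * σ⁻¹ = rot7 := by
  have h1 : ∀ g : Perm (Fin 7), orderOf g = 7 → g.cycleType = {7} := by
    intro g hg
    obtain ⟨n, hn⟩ := cycleType_prime_order (σ := g) (by rw [hg]; norm_num)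
    rw [hg] at hn
    have := sum_cycleType_le g
    rw [hn] at this
    simp at this
    have : n = 0 := by omega
    rw [hn, this]; rfl
  have h2 : orderOf rot7 = 7 := orderOf_eq_prime (by decide) (by decide)
  have h3 : IsConj g rot7 := isConj_iff_cycleType_eq.2 (by rw [h1 g hg, h1 _ h2])
  rwa [isConj_iff] at h3

open Equiv Equiv.Perm in
theorem invol_form {t : Perm (Fin 7)} (ht : orderOf t = 2) (hs : sign t = 1) :
    ∃ a b c d : Fin 7, t = swap a b * swap c d ∧ b ≠ a ∧ c ≠ a ∧ c ≠ b ∧ d ≠ a ∧ d ≠ b ∧ d ≠ c := by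
  obtain ⟨n, hn⟩ := cycleType_prime_order (σ := t) (by rw [ht]; norm_num)
  rw [ht] at hn
  have h1 := sum_cycleType_le t
  have h2 := sign_of_cycleType t
  rw [hn] at h1 h2
  simp at h1
  have hn1 : n = 1 := by
    have : n = 0 ∨ n = 1 ∨ n = 2 := by omega
    rcases this with rfl | rfl | rfl
    · rw [hs] at h2; revert h2; decide
    · rfl
    · rw [hs] at h2; revert h2; decide
  subst hn1
  have h3 : IsConj (swap 0 1 * swap 2 3 : Perm (Fin 7)) t := by
    refine isConj_iff_cycleType_eq.2 ?_
    rw [hn]; decide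
  rw [isConj_iff] at h3
  obtain ⟨τ, rfl⟩ := h3
  refine ⟨τ 0, τ 1, τ 2, τ 3, ?_, ?_, ?_, ?_, ?_, ?_, ?_⟩
  · rw [swap_apply_apply, swap_apply_apply]; group
  all_goals exact τ.injective.ne (by decide)

open Equiv Equiv.Perm in
theorem alt_of_three {K : Subgroup (Perm (Fin 7))} {g q : Perm (Fin 7)} (hg : g ∈ K)
    (h7 : orderOf g = 7) (hq : q ∈ K) (h3 : q.IsThreeCycle) : alternatingGroup (Fin 7) ≤ K := by
  have : MulAction.IsPretransitive K (Fin 7) := by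
    obtain ⟨σ, hσ⟩ := conj_rot7 h7
    have key : ∀ (k : ℕ) (x : Fin 7), (g ^ k) x = σ⁻¹ ((rot7 ^ k) (σ x)) := by
      intro k x
      rw [← hσ, conj_pow]; simp
    have tr : ∀ a b : Fin 7, ∃ k : Fin 7, (rot7 ^ k.val) a = b := by decide
    constructor
    intro x y
    obtain ⟨k, hk⟩ := tr (σ x) (σ y)
    refine ⟨⟨g ^ k.val, K.pow_mem hg _⟩, ?_⟩
    change (g ^ k.val) x = y
    rw [key, hk]; simp
  have hp : MulAction.IsPreprimitive K (Fin 7) :=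
    MulAction.IsPreprimitive.of_prime_card (by simp; norm_num)
  exact alternatingGroup_le_of_isPreprimitive_of_isThreeCycle_mem hp h3 hq

open Equiv Equiv.Perm in
/-- The core step: overgroups of a 7-cycle and an even involution. -/
theorem core14 {K : Subgroup (Perm (Fin 7))} {g t : Perm (Fin 7)} (hg : g ∈ K)
    (h7 : orderOf g = 7) (ht : t ∈ K) (h2 : orderOf t = 2) (hs : sign t = 1) :
    alternatingGroup (Fin 7) ≤ K ∨ ∃ σ : Perm (Fin 7), homPSL.range ≤ K.map (MulAut.conj σ).toMonoidHom := by
  by_contra hcon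
  push Not at hcon
  obtain ⟨hA, hL⟩ := hcon
  obtain ⟨σ, hσ⟩ := conj_rot7 h7
  set K' := K.map (MulAut.conj σ).toMonoidHom with hK'
  have hr : rot7 ∈ K' := ⟨g, hg, by simpa using hσ⟩
  have no3 : ∀ q ∈ K', q.support.card ≠ 3 := by
    rintro _ ⟨q, hq, rfl⟩ h3
    rw [card_support_eq_three_iff] at h3
    apply hA
    refine alt_of_three hg h7 hq ?_
    have : (MulAut.conj σ).toMonoidHom q = σ * q * σ⁻¹ := by simp
    rw [this] at h3
    rwa [IsThreeCycle, cycleType_conj] at h3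
  have nogood : ∀ q ∈ K', ¬ good7 q := by
    rintro q hq (h | ⟨k, h⟩ | ⟨k, h⟩)
    · exact no3 q hq h
    · apply hL σ
      apply homPSL_range_le hr
      rw [← h]
      exact K'.mul_mem (K'.mul_mem (K'.pow_mem hr _) hq) (K'.pow_mem hr _)
    · apply hL (neg7 * σ)
      have hmem : ∀ x ∈ K', neg7 * x * neg7 ∈ K.map (MulAut.conj (neg7 * σ)).toMonoidHom := by
        rintro _ ⟨y, hy, rfl⟩
        refine ⟨y, hy, ?_⟩
        have : neg7⁻¹ = neg7 := by decide
        simp [mul_assoc, this]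
      apply homPSL_range_le
      · have := hmem _ (K'.pow_mem hr 6)
        convert this using 1; decide
      · have : neg7 * invo7 * neg7 ∈ K' := by
          rw [← h]
          exact K'.mul_mem (K'.mul_mem (K'.pow_mem hr _) hq) (K'.pow_mem hr _)
        have := hmem _ this
        convert this using 1; decide
  have ht' : σ * t * σ⁻¹ ∈ K' := ⟨t, ht, by simp⟩
  have h2' : orderOf (σ * t * σ⁻¹) = 2 := by
    rw [← h2]; exact orderOf_injective (MulAut.conj σ).toMonoidHom (MulAut.conj σ).injective t
  obtain ⟨a, b, c, d, hform, n1, n2, n3, n4, n5, n6⟩ := invol_form h2' (by simp [hs])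
  have tr : ∀ a : Fin 7, ∃ k : Fin 7, (rot7 ^ k.val) a = 0 := by decide
  obtain ⟨k, hk⟩ := tr a
  set ρ := rot7 ^ k.val with hρ
  have hρK : ρ ∈ K' := K'.pow_mem hr _
  have e1 : ρ * (σ * t * σ⁻¹) * ρ⁻¹ = swap 0 (ρ b) * swap (ρ c) (ρ d) := by
    rw [← hk, swap_apply_apply, swap_apply_apply, hform]; group
  have e2 : swap 0 (ρ b) * swap (ρ c) (ρ d) ∈ K' := by
    rw [← e1]; exact K'.mul_mem (K'.mul_mem hρK ht') (K'.inv_mem hρK)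
  rcases words_good (ρ b) (ρ c) (ρ d) (by rw [← hk]; exact ρ.injective.ne n1)
    (by rw [← hk]; exact ρ.injective.ne n2) (ρ.injective.ne n3) (by rw [← hk]; exact ρ.injective.ne n4)
    (ρ.injective.ne n5) (ρ.injective.ne n6) with h | ⟨w, _, h⟩
  · exact nogood _ e2 h
  · refine nogood _ ?_ h
    exact K'.pow_mem (K'.mul_mem (K'.mul_mem (K'.mul_mem e2 (K'.pow_mem hr _)) e2) (K'.pow_mem hr _)) _

open Equiv Equiv.Perm in
theorem core14' {K : Subgroup (Perm (Fin 7))} (hK : K ≤ alternatingGroup (Fin 7))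
    (h : 14 ∣ Nat.card K) :
    K = alternatingGroup (Fin 7) ∨ ∃ σ : Perm (Fin 7), homPSL.range ≤ K.map (MulAut.conj σ).toMonoidHom := by
  obtain ⟨g, hg⟩ := exists_prime_orderOf_dvd_card' (G := K) 7 (dvd_trans (by norm_num) h)
  have : Fact (Nat.Prime 2) := ⟨Nat.prime_two⟩
  obtain ⟨t, ht⟩ := exists_prime_orderOf_dvd_card' (G := K) 2 (dvd_trans (by norm_num) h)
  rcases core14 g.2 (by simpa using hg) t.2 (by simpa using ht) (hK t.2) with h | h
  · exact Or.inl (le_antisymm hK h)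
  · exact Or.inr h

theorem card_range_PSL : Nat.card homPSL.range = 168 := by
  rw [← card_PSL]
  exact (Nat.card_congr (MonoidHom.ofInjective homPSL_inj).toEquiv).symm

open Equiv Equiv.Perm in
theorem dvd168 {K : Subgroup (Perm (Fin 7))} {σ : Perm (Fin 7)}
    (h : homPSL.range ≤ K.map (MulAut.conj σ).toMonoidHom) : 168 ∣ Nat.card K := by
  have := Subgroup.card_dvd_of_le h
  rwa [card_range_PSL, Nat.card_congr (K.equivMapOfInjective _ (MulAut.conj σ).injective).toEquiv.symm] at this

open Equiv Equiv.Perm in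
theorem iso168 {K : Subgroup (Perm (Fin 7))} {σ : Perm (Fin 7)} (hc : Nat.card K = 168)
    (h : homPSL.range ≤ K.map (MulAut.conj σ).toMonoidHom) : Nonempty (K ≃* PSL2F7) := by
  have e := K.equivMapOfInjective (MulAut.conj σ).toMonoidHom (MulAut.conj σ).injective
  have h2 : homPSL.range = K.map (MulAut.conj σ).toMonoidHom := by
    apply Subgroup.eq_of_le_of_card_ge h
    rw [card_range_PSL, ← Nat.card_congr e.toEquiv, hc]
  rw [← h2] at e
  exact ⟨e.trans (MonoidHom.ofInjective homPSL_inj).symm⟩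

/-- Subgroup of permutations preserving a boolean colouring. -/
def colSub (f : Fin 7 → Bool) : Subgroup (Equiv.Perm (Fin 7)) where
  carrier := {g | f ∘ g = f}
  one_mem' := rfl
  mul_mem' := by
    intro a b ha hb
    change f ∘ (a * b) = f
    rw [Equiv.Perm.coe_mul, ← Function.comp_assoc, ha, hb]
  inv_mem' := by
    intro a ha
    change f ∘ _ = f
    nth_rw 1 [← show f ∘ a = f from ha]
    ext i; simp

theorem card_colSub (f : Fin 7 → Bool) : Nat.card (colSub f) =
    (Fintype.card {a // f a = true}).factorial * (7 - Fintype.card {a // f a = true}).factorial := by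
  have h1 : Nat.card (colSub f) = Fintype.card {g : Equiv.Perm (Fin 7) // f ∘ g = f} := by
    rw [← Nat.card_eq_fintype_card]; rfl
  rw [h1, DomMulAct.stabilizer_card, Fintype.prod_bool]
  congr 2
  have := Fintype.card_subtype_compl (fun a => f a = true)
  simp only [Fintype.card_fin, Bool.not_eq_true] at this
  exact this

open Equiv Equiv.Perm in
theorem fixed_point {K : Subgroup (Perm (Fin 7))} (h180 : 180 ∣ Nat.card K) (h7 : ¬ 7 ∣ Nat.card K) :
    ∃ a : Fin 7, K ≤ MulAction.stabilizer (Perm (Fin 7)) a := by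
  classical
  have key : ∀ x : Fin 7, Nat.card (MulAction.orbit K x) = 1 ∨ Nat.card (MulAction.orbit K x) = 6 := by
    intro x
    let f : Fin 7 → Bool := fun y => decide (y ∈ MulAction.orbit K x)
    have hle : K ≤ colSub f := by
      intro g hg
      change f ∘ g = f
      ext y
      have : (⟨g, hg⟩ : K) • y ∈ MulAction.orbit K x ↔ y ∈ MulAction.orbit K x := by
        rw [← MulAction.orbit_eq_iff, ← MulAction.orbit_eq_iff, MulAction.orbit_smul]
      simpa [f] using this
    have hd := Subgroup.card_dvd_of_le hle
    rw [card_colSub] at hd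
    have hc : Fintype.card {a // f a = true} = Nat.card (MulAction.orbit K x) := by
      rw [← Nat.card_eq_fintype_card]
      apply Nat.card_congr
      exact Equiv.subtypeEquivRight (by simp [f])
    rw [hc] at hd
    have hdv : Nat.card (MulAction.orbit K x) ∣ Nat.card K := by
      rw [Nat.card_coe_set_eq, ← MulAction.index_stabilizer]
      exact Subgroup.index_dvd_card _
    have hle7 : Nat.card (MulAction.orbit K x) ≤ 7 := by
      have := Finite.card_subtype_le (α := Fin 7) (· ∈ MulAction.orbit K x)
      simpa using this
    have hd' := dvd_trans h180 hd
    generalize Nat.card (MulAction.orbit K x) = n at *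
    interval_cases n <;> simp [Nat.factorial] at * <;> omega
  have fin : ∀ x : Fin 7, Nat.card (MulAction.orbit K x) = 1 → K ≤ MulAction.stabilizer (Perm (Fin 7)) x := by
    intro x hx g hg
    rw [MulAction.mem_stabilizer_iff]
    have := (Nat.card_eq_one_iff_unique.1 hx).1
    exact congrArg Subtype.val (Subsingleton.elim (⟨(⟨g, hg⟩ : K) • x, MulAction.mem_orbit _ _⟩ : MulAction.orbit K x) ⟨x, MulAction.mem_orbit_self x⟩)
  rcases key 0 with h | h
  · exact ⟨0, fin 0 h⟩
  · have : ∃ y, y ∉ MulAction.orbit K (0 : Fin 7) := by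
      by_contra hcon
      push Not at hcon
      have : MulAction.orbit K (0 : Fin 7) = Set.univ := Set.eq_univ_of_forall hcon
      rw [this] at h
      simp at h
    obtain ⟨y, hy⟩ := this
    refine ⟨y, fin y ?_⟩
    rcases key y with h' | h'
    · exact h'
    · exfalso
      have hdis : Disjoint (MulAction.orbit K (0 : Fin 7)) (MulAction.orbit K y) := by
        rw [Set.disjoint_left]
        intro z hz hz'
        apply hy
        rw [← MulAction.orbit_eq_iff] at *
        rw [← hz', hz]
      have := Set.ncard_union_eq hdis
      rw [← Nat.card_coe_set_eq, ← Nat.card_coe_set_eq, ← Nat.card_coe_set_eq, h, h'] at this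
      have h8 := Finite.card_subtype_le (α := Fin 7) (· ∈ MulAction.orbit K 0 ∪ MulAction.orbit K y)
      simp only [Nat.card_eq_fintype_card, Fintype.card_fin] at h8
      rw [← Nat.card_eq_fintype_card] at h8
      change Nat.card ↥(MulAction.orbit K 0 ∪ MulAction.orbit K y) ≤ 7 at h8
      omega
abbrev A7 : Type := alternatingGroup (Fin 7)

theorem card_A7 : Nat.card A7 = 2520 := by
  rw [nat_card_alternatingGroup]; simp [Nat.factorial]

instance simpleA7 : IsSimpleGroup A7 := alternatingGroup.isSimpleGroup (by simp)

/-- Point stabilizers in `A₇`. -/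
def stabA (a : Fin 7) : Subgroup A7 :=
  (MulAction.stabilizer (Equiv.Perm (Fin 7)) a).comap (alternatingGroup (Fin 7)).subtype

theorem stabA_iso (a : Fin 7) : Nonempty (stabA a ≃* alternatingGroup (Fin 6)) := by
  have h1 : stabA a = (alternatingGroup.ofSubtype ({a}ᶜ : Finset (Fin 7))).range := by
    ext k
    rw [alternatingGroup.mem_range_ofSubtype_iff, stabA, Subgroup.mem_comap, MulAction.mem_stabilizer_iff]
    constructor
    · intro h x hx
      rw [Finset.mem_compl, Finset.mem_singleton]
      rintro rfl
      exact Equiv.Perm.mem_support.1 hx h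
    · intro h
      by_contra hc
      have := h (Equiv.Perm.mem_support.2 hc)
      simp at this
  have e1 := MonoidHom.ofInjective (alternatingGroup.ofSubtype_injective (s := ({a}ᶜ : Finset (Fin 7))))
  rw [← h1] at e1
  have hc : Fintype.card ({a}ᶜ : Finset (Fin 7)) = Fintype.card (Fin 6) := by
    simp [Finset.card_compl]
  exact ⟨e1.symm.trans (Equiv.altCongrHom (Fintype.equivOfCardEq hc))⟩

theorem card_stabA (a : Fin 7) : Nat.card (stabA a) = 360 := by
  obtain ⟨e⟩ := stabA_iso a
  rw [Nat.card_congr e.toEquiv, nat_card_alternatingGroup]; simp [Nat.factorial]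

theorem index_stabA (a : Fin 7) : (stabA a).index = 7 := by
  have := (stabA a).index_mul_card
  rw [card_A7, card_stabA] at this
  omega

theorem commutator_top_of_equiv {G H : Type*} [Group G] [Group H] (e : G ≃* H)
    (h : commutator H = ⊤) : commutator G = ⊤ := by
  have h1 : (commutator H).map e.symm.toMonoidHom = commutator G := by
    rw [commutator_def, Subgroup.map_commutator, commutator_def,
      Subgroup.map_top_of_surjective _ e.symm.surjective]
  rw [← h1, h, Subgroup.map_top_of_surjective _ e.symm.surjective]

theorem perfect_stabA (a : Fin 7) : commutator (stabA a) = ⊤ := by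
  obtain ⟨e⟩ := stabA_iso a
  exact commutator_top_of_equiv e (commutator_alternatingGroup_eq_top (by simp))

theorem factorial_bound (J : Subgroup A7) (hJ : J ≠ ⊤) : 2520 ∣ J.index.factorial := by
  have h1 : J.normalCore = ⊥ := by
    rcases (inferInstance : J.normalCore.Normal).eq_bot_or_eq_top with h | h
    · exact h
    · exact absurd (top_le_iff.1 (h ▸ J.normalCore_le)) hJ
  rw [Subgroup.normalCore_eq_ker, MonoidHom.ker_eq_bot_iff] at h1
  have := Subgroup.card_dvd_of_injective _ h1
  rwa [card_A7, Nat.card_perm] at this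

theorem three_mem (J : Subgroup A7) (h : ¬ 3 ∣ J.index) :
    ∃ q ∈ J.map (alternatingGroup (Fin 7)).subtype, q.IsThreeCycle := by
  have : Fact (Nat.Prime 3) := ⟨Nat.prime_three⟩
  let q : Equiv.Perm (Fin 7) := Equiv.swap 0 1 * Equiv.swap 0 2
  have hq : q.IsThreeCycle := by rw [← card_support_eq_three_iff]; decide
  let q' : A7 := ⟨q, hq.mem_alternatingGroup⟩
  have ho : orderOf q' = 3 := by
    rw [← hq.orderOf]; exact (Subgroup.orderOf_coe q').symm
  have hP : IsPGroup 3 (Subgroup.zpowers q') := by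
    apply IsPGroup.of_card (n := 1)
    rw [Nat.card_zpowers, ho, pow_one]
  have hm := hP.card_modEq_card_fixedPoints (A7 ⧸ J)
  have hne : Nat.card (MulAction.fixedPoints (Subgroup.zpowers q') (A7 ⧸ J)) ≠ 0 := by
    intro h0
    rw [h0] at hm
    exact h ((Nat.modEq_zero_iff_dvd).1 hm)
  obtain ⟨⟨x, hx⟩⟩ := (Nat.card_ne_zero.1 hne).1
  obtain ⟨g, rfl⟩ := QuotientGroup.mk_surjective x
  have h1 := hx ⟨q', Subgroup.mem_zpowers q'⟩
  have h2 : ((q' * g : A7) : A7 ⧸ J) = g := h1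
  have h3 : g⁻¹ * q' * g ∈ J := by
    have := QuotientGroup.eq.1 h2.symm
    rwa [← mul_assoc] at this
  refine ⟨_, ⟨_, h3, rfl⟩, ?_⟩
  have : ((alternatingGroup (Fin 7)).subtype (g⁻¹ * q' * g)) = (g : Equiv.Perm (Fin 7))⁻¹ * q * ((g : Equiv.Perm (Fin 7))⁻¹)⁻¹ := by
    simp [q']
  rw [this, Equiv.Perm.IsThreeCycle, Equiv.Perm.cycleType_conj]
  exact hq

theorem class7 (J : Subgroup A7) (hJ : J ≠ ⊤) (hi : J.index ≤ 15) :
    (J.index = 7 ∧ ∃ a, J = stabA a) ∨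
    (J.index = 15 ∧ Nonempty (J.map (alternatingGroup (Fin 7)).subtype ≃* PSL2F7)) := by
  set K := J.map (alternatingGroup (Fin 7)).subtype with hK
  have hle : K ≤ alternatingGroup (Fin 7) := by
    rintro _ ⟨x, _, rfl⟩; exact x.2
  have hcK : Nat.card K = Nat.card J :=
    (Nat.card_congr (J.equivMapOfInjective _ (alternatingGroup (Fin 7)).subtype_injective).toEquiv).symm
  have hcomap : K.comap (alternatingGroup (Fin 7)).subtype = J :=
    Subgroup.comap_map_eq_self_of_injective (alternatingGroup (Fin 7)).subtype_injective J
  have hprod : J.index * Nat.card K = 2520 := by rw [hcK, J.index_mul_card, card_A7]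
  have hnA : ¬ alternatingGroup (Fin 7) ≤ K := by
    intro h
    apply hJ
    rw [← hcomap, eq_top_iff]
    intro x _
    exact h x.2
  have hf := factorial_bound J hJ
  have h3 : ¬ 3 ∣ J.index → ¬ 7 ∣ Nat.card K := by
    intro h h7
    obtain ⟨q, hq, hq3⟩ := three_mem J h
    obtain ⟨g, hg⟩ := exists_prime_orderOf_dvd_card' (G := K) 7 h7
    exact hnA (alt_of_three g.2 (by simpa using hg) hq hq3)
  have h14 : 14 ∣ Nat.card K → ∃ σ : Equiv.Perm (Fin 7), homPSL.range ≤ K.map (MulAut.conj σ).toMonoidHom := by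
    intro h
    rcases core14' hle h with h | h
    · exact absurd h.ge hnA
    · exact h
  have hfix : 180 ∣ Nat.card K → ¬ 7 ∣ Nat.card K → ∃ a, J ≤ stabA a := by
    intro h1 h2
    obtain ⟨a, ha⟩ := fixed_point h1 h2
    refine ⟨a, ?_⟩
    rw [← hcomap]
    exact Subgroup.comap_mono ha
  have h168 : 14 ∣ Nat.card K → 168 ∣ Nat.card K := fun h => by
    obtain ⟨σ, hσ⟩ := h14 h
    exact dvd168 hσ
  have hn : J.index = 7 ∨ J.index = 14 ∨ J.index = 15 := by
    generalize J.index = n at *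
    generalize Nat.card K = m at *
    interval_cases n <;> simp [Nat.factorial] at hf h3 ⊢ <;> omega
  rcases hn with hn | hn | hn
  · left
    have hm : Nat.card K = 360 := by rw [hn] at hprod; omega
    obtain ⟨a, ha⟩ := hfix (by rw [hm]; norm_num) (by rw [hm]; norm_num)
    refine ⟨hn, a, Subgroup.eq_of_le_of_card_ge ha ?_⟩
    rw [card_stabA, ← hcK, hm]
  · exfalso
    have hm : Nat.card K = 180 := by rw [hn] at hprod; omega
    obtain ⟨a, ha⟩ := hfix (by rw [hm]) (by rw [hm]; norm_num)
    have h1 := Subgroup.relIndex_mul_index ha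
    rw [index_stabA, hn] at h1
    have h2 : (J.subgroupOf (stabA a)).index = 2 := by
      change J.relIndex (stabA a) = 2
      omega
    have h4 : (J.subgroupOf (stabA a)).Normal := Subgroup.normal_of_index_eq_two h2
    have : Fact (Nat.Prime 2) := ⟨Nat.prime_two⟩
    have h5 : commutator (stabA a) ≤ J.subgroupOf (stabA a) := by
      have hcyc : IsCyclic (stabA a ⧸ J.subgroupOf (stabA a)) := isCyclic_of_prime_card (p := 2) h2
      rw [commutator_def, Subgroup.commutator_le]
      intro x _ y _
      rw [← QuotientGroup.eq_one_iff, ← QuotientGroup.mk'_apply, map_commutatorElement, commutatorElement_eq_one_iff_mul_comm]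
      letI := IsCyclic.commGroup (α := stabA a ⧸ J.subgroupOf (stabA a))
      exact mul_comm _ _
    rw [perfect_stabA, top_le_iff] at h5
    rw [h5] at h2
    simp at h2
  · right
    have hm : Nat.card K = 168 := by rw [hn] at hprod; omega
    obtain ⟨σ, hσ⟩ := h14 (by rw [hm]; norm_num)
    exact ⟨hn, iso168 hm hσ⟩

theorem transfer_central {G : Type*} [Group G] [Finite G] (H : Subgroup G) {A : Type*} [CommGroup A]
    (φ : H →* A) (z : G) (hz : z ∈ Subgroup.center G) (hc : z ∈ commutator G) :
    ∃ hm : z ^ H.index ∈ H, φ ⟨z ^ H.index, hm⟩ = 1 := by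
  have h1 := MonoidHom.transfer_eq_pow φ z (fun k g₀ _ => by
    have : z ^ k ∈ Subgroup.center G := Subgroup.pow_mem _ hz k
    rw [mul_assoc, ← Subgroup.mem_center_iff.1 this g₀]
    simp)
  refine ⟨_, h1.symm.trans ?_⟩
  exact Abelianization.commutator_subset_ker (MonoidHom.transfer φ) hc

theorem map_comm_top {E Q : Type*} [Group E] [Group Q] (π : E →* Q)
    (hs : Function.Surjective π) (hQ : commutator Q = ⊤) : (commutator E).map π = ⊤ := by
  rw [← hQ, commutator_def, commutator_def, Subgroup.map_commutator,
    Subgroup.map_top_of_surjective π hs]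

theorem ext_perfect {E Q : Type*} [Group E] [Group Q] (π : E →* Q)
    (hs : Function.Surjective π) (hQ : commutator Q = ⊤) (hk : π.ker ≤ commutator E) :
    commutator E = ⊤ := by
  have h := map_comm_top π hs hQ
  rw [← Subgroup.comap_map_eq_self hk, h, Subgroup.comap_top]

theorem cover6 {E Q : Type*} [Group E] [Group Q] (π : E →* Q)
    (hs : Function.Surjective π) (hQ : commutator Q = ⊤) (hk : π.ker ≤ commutator E)
    (hz : π.ker ≤ Subgroup.center E) (hc : Nat.card π.ker = 3)
    (e : Q ≃* alternatingGroup (Fin 6)) : IsTripleCoverA6 E := by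
  have hcA : Subgroup.center (alternatingGroup (Fin 6)) = ⊥ :=
    alternatingGroup.center_eq_bot (by simp)
  have hcen : Subgroup.center E = π.ker := by
    refine le_antisymm (fun x hx => ?_) hz
    have h1 : e (π x) ∈ Subgroup.center (alternatingGroup (Fin 6)) := by
      rw [Subgroup.mem_center_iff]
      intro g
      obtain ⟨q, rfl⟩ := e.surjective g
      obtain ⟨y, rfl⟩ := hs q
      rw [← map_mul, ← map_mul, ← map_mul, ← map_mul, Subgroup.mem_center_iff.1 hx y]
    rw [hcA, Subgroup.mem_bot] at h1
    rw [MonoidHom.mem_ker]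
    exact e.injective (by rw [h1, map_one])
  have : Fact (Nat.Prime 3) := ⟨by norm_num⟩
  refine ⟨ext_perfect π hs hQ hk, ?_, ?_, ?_⟩
  · rw [hcen]
    exact isCyclic_of_prime_card hc
  · rw [hcen, hc]
  · exact ⟨((QuotientGroup.quotientMulEquivOfEq hcen).trans
      (QuotientGroup.quotientKerEquivOfSurjective π hs)).trans e⟩

theorem split168 {E Q : Type*} [Group E] [Finite E] [Group Q] (π : E →* Q)
    (hs : Function.Surjective π) (hQ : commutator Q = ⊤) (hQc : Nat.card Q = 168)
    (hz : π.ker ≤ Subgroup.center E) (hc : Nat.card π.ker = 3) :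
    Nonempty (E ≃* Q × Multiplicative (ZMod 3)) := by
  have : Fact (Nat.Prime 3) := ⟨by norm_num⟩
  have hE : Nat.card E = 504 := by
    have h1 := Subgroup.card_mul_index π.ker
    rw [Subgroup.index_ker, MonoidHom.range_eq_top.2 hs, hc] at h1
    rw [← h1, Nat.card_congr (Subgroup.topEquiv (G := Q)).toEquiv, hQc]
  obtain ⟨P, hP⟩ := Sylow.exists_subgroup_card_pow_prime (G := E) 3 (n := 2)
    (by rw [hE]; norm_num)
  have hPi : P.index = 56 := by
    have := Subgroup.card_mul_index P
    rw [hE, hP] at this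
    omega
  have hdis : ∀ z ∈ π.ker, z ∈ commutator E → z = 1 := by
    intro z hzk hzc
    have h3 : z ^ 3 = 1 := by
      have := pow_card_eq_one' (G := π.ker) (x := ⟨z, hzk⟩)
      rw [hc] at this
      simpa using congrArg Subtype.val this
    have hcomm := IsPGroup.isMulCommutative_of_card_eq_prime_sq hP
    let iP : CommGroup P :=
      { (inferInstance : Group P) with mul_comm := fun a b => hcomm.is_comm.comm a b }
    obtain ⟨hm, h⟩ := transfer_central P (A := P) (MonoidHom.id P) z (hz hzk) hzc
    have h56 : z ^ 56 = 1 := by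
      have := congrArg Subtype.val h
      simpa [hPi] using this
    calc z = (z ^ 3) ^ 19 * (z ^ 56)⁻¹ := by rw [← pow_mul]; group
      _ = 1 := by rw [h3, h56]; simp
  have hinj : Function.Injective (π.prod (Abelianization.of (G := E))) := by
    rw [injective_iff_map_eq_one]
    intro x hx
    rw [MonoidHom.prod_apply, Prod.mk_eq_one] at hx
    refine hdis x hx.1 ?_
    rw [← Abelianization.ker_of]
    exact hx.2
  have hab : Nat.card (Abelianization E) = 3 := by
    have h1 : Nat.card (commutator E) = 168 := by
      have hi : Function.Injective (π.comp (commutator E).subtype) := by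
        rw [injective_iff_map_eq_one]
        intro x hx
        exact Subtype.ext (hdis x.1 hx x.2)
      have hsu : Function.Surjective (π.comp (commutator E).subtype) := by
        intro q
        have : q ∈ (commutator E).map π := by rw [map_comm_top π hs hQ]; trivial
        obtain ⟨x, hx, rfl⟩ := this
        exact ⟨⟨x, hx⟩, rfl⟩
      rw [Nat.card_eq_of_bijective _ ⟨hi, hsu⟩, hQc]
    have h2 := Subgroup.card_mul_index (commutator E)
    rw [hE, h1] at h2
    change (commutator E).index = 3
    omega
  have : Finite Q := Nat.finite_of_card_ne_zero (by rw [hQc]; norm_num)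
  have : Finite (Abelianization E) := Nat.finite_of_card_ne_zero (by rw [hab]; norm_num)
  have hbij := (Nat.bijective_iff_injective_and_card _).2
    ⟨hinj, by rw [Nat.card_prod, hE, hQc, hab]⟩
  exact ⟨(MulEquiv.ofBijective _ hbij).trans
    ((MulEquiv.refl Q).prodCongr (mulEquivOfPrimeCardEq (p := 3) hab (by simp)))⟩

section Cover
variable {G : Type} [Group G] [Finite G]

theorem comap_ker_props (hG : IsTripleCoverA7 G) (ν : G →* A7)
    (hker : ν.ker = Subgroup.center G) (J : Subgroup A7) :
    (ν.subgroupComap J).ker ≤ Subgroup.center (J.comap ν) ∧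
      Nat.card (ν.subgroupComap J).ker = 3 := by
  have hmem : ∀ x : J.comap ν, x ∈ (ν.subgroupComap J).ker ↔ x.1 ∈ Subgroup.center G := by
    intro x
    rw [← hker, MonoidHom.mem_ker, MonoidHom.mem_ker, Subtype.ext_iff]
    rfl
  constructor
  · intro x hx
    rw [Subgroup.mem_center_iff]
    intro g
    exact Subtype.ext (Subgroup.mem_center_iff.1 ((hmem x).1 hx) g.1)
  · rw [← hG.2.2.1, ← Subgroup.card_map_of_injective (J.comap ν).subtype_injective]
    congr 2
    ext x
    constructor
    · rintro ⟨y, hy, rfl⟩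
      exact (hmem y).1 hy
    · intro hx
      refine ⟨⟨x, ?_⟩, (hmem _).2 hx, rfl⟩
      rw [← hker, MonoidHom.mem_ker] at hx
      rw [Subgroup.mem_comap, hx]
      exact one_mem _

theorem cover_stab (hG : IsTripleCoverA7 G) (ν : G →* A7)
    (hsurj : Function.Surjective ν) (hker : ν.ker = Subgroup.center G) (a : Fin 7) :
    IsTripleCoverA6 ((stabA a).comap ν) := by
  obtain ⟨hz, hc⟩ := comap_ker_props hG ν hker (stabA a)
  obtain ⟨e⟩ := stabA_iso a
  refine cover6 (ν.subgroupComap (stabA a))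
    (ν.subgroupComap_surjective_of_surjective _ hsurj) (perfect_stabA a) ?_ hz hc e
  intro x hx
  have h3 : x ^ 3 = 1 := by
    have := pow_card_eq_one' (G := (ν.subgroupComap (stabA a)).ker) (x := ⟨x, hx⟩)
    rw [hc] at this
    simpa using congrArg Subtype.val this
  have hxc : x.1 ∈ Subgroup.center G := by
    rw [← hker, MonoidHom.mem_ker]
    exact congrArg Subtype.val hx
  obtain ⟨hm, h⟩ := transfer_central ((stabA a).comap ν) Abelianization.of x.1 hxc
    (by rw [hG.1]; trivial)
  have hx7 : (⟨x.1 ^ ((stabA a).comap ν).index, hm⟩ : (stabA a).comap ν) = x := by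
    apply Subtype.ext
    change x.1 ^ ((stabA a).comap ν).index = x.1
    rw [Subgroup.index_comap_of_surjective _ hsurj, index_stabA]
    have h3' : x.1 ^ 3 = 1 := congrArg Subtype.val h3
    calc x.1 ^ 7 = (x.1 ^ 3) ^ 2 * x.1 := by group
      _ = x.1 := by rw [h3']; simp
  rw [hx7] at h
  rw [← Abelianization.ker_of]
  exact h

theorem cover_psl (hG : IsTripleCoverA7 G) (ν : G →* A7)
    (hsurj : Function.Surjective ν) (hker : ν.ker = Subgroup.center G) (J : Subgroup A7)
    (e : J ≃* PSL2F7) :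
    Nonempty (J.comap ν ≃* PSL2F7 × Multiplicative (ZMod 3)) := by
  obtain ⟨hz, hc⟩ := comap_ker_props hG ν hker J
  obtain ⟨f⟩ := split168 (ν.subgroupComap J) (ν.subgroupComap_surjective_of_surjective _ hsurj)
    (commutator_top_of_equiv e perfectPSL)
    (by rw [Nat.card_congr e.toEquiv, card_PSL]) hz hc
  exact ⟨f.trans (e.prodCongr (MulEquiv.refl _))⟩

theorem class_comap (ν : G →* A7) (hsurj : Function.Surjective ν)
    (hker : ν.ker = Subgroup.center G) (H : Subgroup G) (hH : H ≠ ⊤) (hi : H.index ≤ 15)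
    (hZ : Subgroup.center G ≤ H) :
    (H.index = 7 ∧ ∃ a, H = (stabA a).comap ν) ∨
    (H.index = 15 ∧ ∃ J : Subgroup A7, H = J.comap ν ∧
      Nonempty (J.map (alternatingGroup (Fin 7)).subtype ≃* PSL2F7)) := by
  have hJ : H = (H.map ν).comap ν := (Subgroup.comap_map_eq_self (hker ▸ hZ)).symm
  have hind : H.index = (H.map ν).index := by
    conv_lhs => rw [hJ]
    exact Subgroup.index_comap_of_surjective _ hsurj
  have hne : H.map ν ≠ ⊤ := by
    intro h
    rw [h, Subgroup.comap_top] at hJ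
    exact hH hJ
  rcases class7 (H.map ν) hne (hind ▸ hi) with ⟨h1, a, ha⟩ | ⟨h1, h2⟩
  · exact Or.inl ⟨hind.trans h1, a, ha ▸ hJ⟩
  · exact Or.inr ⟨hind.trans h1, _, hJ, h2⟩

theorem center_le_of_index (hG : IsTripleCoverA7 G) (ν : G →* A7)
    (hsurj : Function.Surjective ν) (hker : ν.ker = Subgroup.center G)
    (H : Subgroup G) (hH : H ≠ ⊤) (hi : H.index ≤ 15) : Subgroup.center G ≤ H := by
  have htop : H ⊔ Subgroup.center G ≠ ⊤ := by
    intro h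
    apply hH
    rw [eq_top_iff, ← hG.1, commutator_def, Subgroup.commutator_le]
    intro x hx y hy
    rw [← h] at hx hy
    obtain ⟨x1, hx1, x2, hx2, rfl⟩ := Subgroup.mem_sup_of_normal_right.1 hx
    obtain ⟨y1, hy1, y2, hy2, rfl⟩ := Subgroup.mem_sup_of_normal_right.1 hy
    have e1 := Subgroup.mem_center_iff.1 hx2
    have e2 := Subgroup.mem_center_iff.1 hy2
    have e3 := Subgroup.mem_center_iff.1 (inv_mem hx2)
    have e4 := Subgroup.mem_center_iff.1 (inv_mem hy2)
    have : x1 * x2 * (y1 * y2) * (x1 * x2)⁻¹ * (y1 * y2)⁻¹ = x1 * y1 * x1⁻¹ * y1⁻¹ := by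
      simp only [mul_inv_rev]
      calc x1 * x2 * (y1 * y2) * (x2⁻¹ * x1⁻¹) * (y2⁻¹ * y1⁻¹)
          = x1 * (x2 * (y1 * y2)) * (x2⁻¹ * x1⁻¹) * (y2⁻¹ * y1⁻¹) := by group
        _ = x1 * y1 * (y2 * x1⁻¹) * (y2⁻¹ * y1⁻¹) := by rw [← e1]; group
        _ = x1 * y1 * x1⁻¹ * y1⁻¹ := by rw [← e2]; group
    rw [commutatorElement_def, this]
    exact mul_mem (mul_mem (mul_mem hx1 hy1) (inv_mem hx1)) (inv_mem hy1)
  have hmul : H.relIndex (H ⊔ Subgroup.center G) * (H ⊔ Subgroup.center G).index = H.index :=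
    Subgroup.relIndex_mul_index le_sup_left
  have hpos : H.index ≠ 0 := Subgroup.index_ne_zero_of_finite
  have hle : (H ⊔ Subgroup.center G).index ≤ H.index :=
    Subgroup.index_antitone le_sup_left
  have h7 : 7 ≤ (H ⊔ Subgroup.center G).index := by
    rcases class_comap ν hsurj hker _ htop (hle.trans hi) le_sup_right with h | h <;> omega
  have hrel : H.relIndex (H ⊔ Subgroup.center G) ∣ 3 := by
    have r1 := Subgroup.relIndex_mul_relIndex ⊥ H (H ⊔ Subgroup.center G) bot_le le_sup_left
    have r2 := Subgroup.relIndex_mul_relIndex ⊥ (Subgroup.center G) (H ⊔ Subgroup.center G)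
      bot_le le_sup_right
    have r3 := Subgroup.relIndex_mul_relIndex ⊥ (Subgroup.center G ⊓ H) H bot_le inf_le_right
    rw [Subgroup.inf_relIndex_right] at r3
    rw [Subgroup.relIndex_sup_right] at r2
    simp only [Subgroup.relIndex_bot_left] at r1 r2 r3
    rw [hG.2.2.1] at r2
    have hq : 0 < (Subgroup.center G).relIndex H := by
      rw [Nat.pos_iff_ne_zero]
      intro h0
      rw [h0, mul_zero] at r3
      exact Nat.card_pos.ne r3
    refine Dvd.intro_left (Nat.card (Subgroup.center G ⊓ H : Subgroup G)) ?_
    apply Nat.eq_of_mul_eq_mul_right hq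
    rw [r2, ← r1, ← r3]
    ring
  have h1 : H.relIndex (H ⊔ Subgroup.center G) = 1 := by
    rcases (Nat.dvd_prime (by norm_num : Nat.Prime 3)).1 hrel with h | h
    · exact h
    · rw [h] at hmul; omega
  exact le_sup_right.trans (Subgroup.relIndex_eq_one.1 h1)

end Cover

/-- Let `G = 3.A₇` with center `Z` (of order `3`) and quotient map `ν : G → A₇`.  Every proper
subgroup of `G` of index at most `15` contains `Z`, and, up to conjugacy, the proper subgroups
of index at most `15` are exactly: the preimage `ν⁻¹(A₆)` of a point stabiliser `A₆ ⊂ A₇`,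
of index `7` and isomorphic to `3.A₆`; and the preimage `ν⁻¹(PSL₂(F₇))` of a subgroup
`PSL₂(F₇) ⊂ A₇`, of index `15` and isomorphic to `PSL₂(F₇) × ℤ/3ℤ`. -/
theorem small_index_subgroups_of_3A7
    (G : Type) [Group G] [Finite G] (hG : IsTripleCoverA7 G)
    (ν : G →* alternatingGroup (Fin 7))
    (hsurj : Function.Surjective ν) (hker : ν.ker = Subgroup.center G) :
    (∀ H : Subgroup G, H ≠ ⊤ → H.index ≤ 15 →
      Subgroup.center G ≤ H ∧
      ((H.index = 7 ∧
        (∃ a : Fin 7, H = Subgroup.comap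
          (((alternatingGroup (Fin 7)).subtype).comp ν)
          (MulAction.stabilizer (Equiv.Perm (Fin 7)) a)) ∧
        IsTripleCoverA6 H) ∨
       (H.index = 15 ∧
        (∃ K : Subgroup (Equiv.Perm (Fin 7)), K ≤ alternatingGroup (Fin 7) ∧
          Nonempty (K ≃* PSL2F7) ∧
          H = Subgroup.comap (((alternatingGroup (Fin 7)).subtype).comp ν) K) ∧
        Nonempty (H ≃* PSL2F7 × Multiplicative (ZMod 3))))) ∧
    (∀ a : Fin 7,
      (Subgroup.comap (((alternatingGroup (Fin 7)).subtype).comp ν)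
        (MulAction.stabilizer (Equiv.Perm (Fin 7)) a)).index = 7 ∧
      IsTripleCoverA6 (Subgroup.comap (((alternatingGroup (Fin 7)).subtype).comp ν)
        (MulAction.stabilizer (Equiv.Perm (Fin 7)) a))) ∧
    (∃ K : Subgroup (Equiv.Perm (Fin 7)), K ≤ alternatingGroup (Fin 7) ∧
      Nonempty (K ≃* PSL2F7) ∧
      (Subgroup.comap (((alternatingGroup (Fin 7)).subtype).comp ν) K).index = 15 ∧
      Nonempty ((Subgroup.comap (((alternatingGroup (Fin 7)).subtype).comp ν) K) ≃*
        PSL2F7 × Multiplicative (ZMod 3))) := by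
  refine ⟨fun H hH hi => ?_, fun a => ⟨?_, cover_stab hG ν hsurj hker a⟩, ?_⟩
  · have hZ := center_le_of_index hG ν hsurj hker H hH hi
    refine ⟨hZ, ?_⟩
    rcases class_comap ν hsurj hker H hH hi hZ with ⟨h1, a, ha⟩ | ⟨h1, J, hJ, ⟨e⟩⟩
    · refine Or.inl ⟨h1, ⟨a, ha⟩, ?_⟩
      rw [ha]
      exact cover_stab hG ν hsurj hker a
    · refine Or.inr ⟨h1, ⟨J.map (alternatingGroup (Fin 7)).subtype, ?_, ⟨e⟩, ?_⟩, ?_⟩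
      · rintro _ ⟨x, -, rfl⟩
        exact x.2
      · rw [← Subgroup.comap_comap, Subgroup.comap_map_eq_self_of_injective
          (Subgroup.subtype_injective _)]
        exact hJ
      · rw [hJ]
        exact cover_psl hG ν hsurj hker J
          ((J.equivMapOfInjective _ (Subgroup.subtype_injective _)).trans e)
  · exact (Subgroup.index_comap_of_surjective (stabA a) hsurj).trans (index_stabA a)
  · let e : homPSL.range ≃* PSL2F7 := (MonoidHom.ofInjective homPSL_inj).symm
    let J : Subgroup A7 := homPSL.range.subgroupOf (alternatingGroup (Fin 7))
    let f : J ≃* homPSL.range := Subgroup.subgroupOfEquivOfLe homPSL_alt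
    refine ⟨homPSL.range, homPSL_alt, ⟨e⟩, ?_, cover_psl hG ν hsurj hker J (f.trans e)⟩
    refine (Subgroup.index_comap_of_surjective J hsurj).trans ?_
    have h1 := Subgroup.card_mul_index J
    rw [card_A7, Nat.card_congr f.toEquiv, card_range_PSL] at h1
    omega
end

section
/- Let V be a faithful irreducible three-dimensional complex representation of the quasi-simple group 3.A6 (the Valentiner group). Then there are no nonzero 3.A6-invariant homogeneous polynomial functions on V of degree 1, 2, 3, 4, or 5, and the space of invariant homogeneous polynomials of degree 6 is one-dimensional. -/
/-- The space of homogeneous polynomial functions of degree `d` on `V`: the span, inside the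
space of all functions `V → ℂ`, of products of `d` linear functionals. -/
noncomputable def homPoly (V : Type*) [AddCommGroup V] [Module ℂ V] (d : ℕ) :
    Submodule ℂ (V → ℂ) :=
  Submodule.span ℂ {f | ∃ φ : Fin d → Module.Dual ℂ V, f = fun v => ∏ i, φ i v}


theorem vi_eigenbasis {V : Type} [AddCommGroup V] [Module ℂ V] [FiniteDimensional ℂ V]
    (hdim : Module.finrank ℂ V = 3) (T : Module.End ℂ V) (n : ℕ) (hn : n ≠ 0) (hT : T ^ n = 1) :
    ∃ (b : Module.Basis (Fin 3) ℂ V) (l : Fin 3 → ℂ), ∀ i, T (b i) = l i • b i := by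
  have hss : T.IsSemisimple := by
    apply Module.End.isSemisimple_of_squarefree_aeval_eq_zero (p := Polynomial.X ^ n - Polynomial.C 1)
    · exact (Polynomial.separable_X_pow_sub_C (1 : ℂ) (by exact_mod_cast hn) one_ne_zero).squarefree
    · simp [hT]
  have htop := hss.iSup_eigenspace_eq_top
  have hint : DirectSum.IsInternal (fun μ : ℂ => T.eigenspace μ) :=
    (DirectSum.isInternal_submodule_iff_iSupIndep_and_iSup_eq_top _).2
      ⟨T.eigenspaces_iSupIndep, htop⟩
  let B := hint.collectedBasis (fun μ => Module.finBasis ℂ (T.eigenspace μ))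
  have hfin : Finite (Σ μ : ℂ, Fin (Module.finrank ℂ (T.eigenspace μ))) := Module.Finite.finite_basis B
  have hcard := Module.finrank_eq_nat_card_basis B
  rw [hdim] at hcard
  let e := Finite.equivFinOfCardEq hcard.symm
  refine ⟨B.reindex e, fun i => (e.symm i).1, fun i => ?_⟩
  have := hint.collectedBasis_mem (fun μ => Module.finBasis ℂ (T.eigenspace μ)) (e.symm i)
  simpa [B] using Module.End.mem_eigenspace_iff.1 this

/-- evaluation of polynomials in coordinates -/
noncomputable def viPsi {V : Type} [AddCommGroup V] [Module ℂ V]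
    (b : Module.Basis (Fin 3) ℂ V) : MvPolynomial (Fin 3) ℂ →ₗ[ℂ] (V → ℂ) where
  toFun p := fun v => MvPolynomial.eval (fun i => b.coord i v) p
  map_add' p q := by ext v; simp
  map_smul' c p := by ext v; simp [MvPolynomial.smul_eval]

theorem viPsi_inj {V : Type} [AddCommGroup V] [Module ℂ V]
    (b : Module.Basis (Fin 3) ℂ V) : LinearMap.ker (viPsi b) = ⊥ := by
  rw [LinearMap.ker_eq_bot']
  intro p hp
  apply MvPolynomial.funext
  intro x
  have := congrFun hp (b.equivFun.symm x)
  simpa [viPsi, Module.Basis.equivFun_symm_apply, Finsupp.single_apply] using this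

/-- exponent vectors -/
abbrev ViIdx (d : ℕ) := {s : Fin 3 → ℕ // s ∈ Finset.Nat.antidiagonalTuple 3 d}

theorem vi_mon_mem {V : Type} [AddCommGroup V] [Module ℂ V]
    (b : Module.Basis (Fin 3) ℂ V) {d : ℕ} (s : ViIdx d) :
    (fun v => ∏ j, (b.coord j v) ^ (s.1 j)) ∈ homPoly V d := by
  obtain ⟨s, hs⟩ := s
  rw [Finset.Nat.mem_antidiagonalTuple] at hs
  subst hs
  apply Submodule.subset_span
  refine ⟨fun i => b.coord (finSigmaFinEquiv.symm i).1, ?_⟩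
  ext v
  rw [← Equiv.prod_comp finSigmaFinEquiv]
  simp [Fintype.prod_sigma]

theorem vi_basis {V : Type} [AddCommGroup V] [Module ℂ V]
    (b : Module.Basis (Fin 3) ℂ V) (d : ℕ) :
    ∃ B : Module.Basis (ViIdx d) ℂ (homPoly V d), ∀ s : ViIdx d,
      (B s : V → ℂ) = fun v => ∏ j, (b.coord j v) ^ (s.1 j) := by
  let m : ViIdx d → homPoly V d := fun s => ⟨_, vi_mon_mem b s⟩
  have hm : ∀ s, (m s : V → ℂ) = fun v => ∏ j, (b.coord j v) ^ (s.1 j) := fun s => rfl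
  have hli : LinearIndependent ℂ m := by
    apply LinearIndependent.of_comp (homPoly V d).subtype
    have h1 := (MvPolynomial.basisMonomials (Fin 3) ℂ).linearIndependent
    have h2 := h1.comp (fun s : ViIdx d => Finsupp.equivFunOnFinite.symm s.1)
      (fun s t h => Subtype.ext (Finsupp.equivFunOnFinite.symm.injective h))
    have h3 := h2.map' (viPsi b) (viPsi_inj b)
    have h4 : (homPoly V d).subtype ∘ m = viPsi b ∘ (MvPolynomial.basisMonomials (Fin 3) ℂ) ∘
        (fun s : ViIdx d => Finsupp.equivFunOnFinite.symm s.1) := by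
      ext s v
      simp [m, viPsi, MvPolynomial.eval_monomial, Finsupp.prod_fintype]
    rw [h4]
    exact h3
  have hsp : ⊤ ≤ Submodule.span ℂ (Set.range m) := by
    have : homPoly V d ≤ (Submodule.span ℂ (Set.range m)).map (homPoly V d).subtype := by
      rw [Submodule.map_span]
      conv_lhs => unfold homPoly
      rw [Submodule.span_le]
      rintro f ⟨φ, rfl⟩
      have : (fun v => ∏ i, φ i v) = ∑ x ∈ Fintype.piFinset (fun _ : Fin d => (Finset.univ : Finset (Fin 3))),
          (∏ i, φ i (b (x i))) • (fun v => ∏ i, b.coord (x i) v) := by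
        ext v
        have h : ∀ i, φ i v = ∑ j, φ i (b j) * b.coord j v := by
          intro i
          conv_lhs => rw [← b.sum_repr v]
          rw [map_sum]
          refine Finset.sum_congr rfl fun j _ => ?_
          rw [map_smul, smul_eq_mul, mul_comm, Module.Basis.coord_apply]
        simp_rw [h]
        rw [Finset.prod_univ_sum]
        simp [Finset.prod_mul_distrib, Finset.sum_apply]
      rw [this]
      apply Submodule.sum_mem
      intro x _
      apply Submodule.smul_mem
      apply Submodule.subset_span
      refine ⟨_, ⟨⟨fun j => (Finset.univ.filter (fun i => x i = j)).card, ?_⟩, rfl⟩, ?_⟩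
      · rw [Finset.Nat.mem_antidiagonalTuple]
        rw [← Finset.card_eq_sum_card_fiberwise (f := x) (t := Finset.univ) (by simp)]
        simp
      · ext v
        simp only [m, Submodule.subtype_apply]
        rw [← Finset.prod_fiberwise (s := Finset.univ) (g := x)]
        refine Finset.prod_congr rfl fun j _ => ?_
        rw [Finset.prod_congr rfl (g := fun _ => b.coord j v)]
        · simp
        · intro i hi
          simp at hi
          simp [hi]
    intro f _
    obtain ⟨y, hy, hyf⟩ := this f.2
    have : y = f := Subtype.ext hyf
    exact this ▸ hy
  exact ⟨Module.Basis.mk hli hsp, fun s => by rw [Module.Basis.mk_apply]⟩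

theorem vi_comp_mem {V : Type} [AddCommGroup V] [Module ℂ V] (d : ℕ) (T : Module.End ℂ V) :
    ∀ f ∈ homPoly V d, LinearMap.funLeft ℂ ℂ T f ∈ homPoly V d := by
  intro f hf
  have : homPoly V d ≤ (homPoly V d).comap (LinearMap.funLeft ℂ ℂ T) := by
    conv_lhs => unfold homPoly
    rw [Submodule.span_le]
    rintro f ⟨φ, rfl⟩
    exact Submodule.subset_span ⟨fun i => (φ i).comp T, rfl⟩
  exact this hf

/-- precomposition -/
noncomputable def viPull (V : Type) [AddCommGroup V] [Module ℂ V] (d : ℕ) (T : Module.End ℂ V) :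
    Module.End ℂ (homPoly V d) :=
  (LinearMap.funLeft ℂ ℂ T).restrict (vi_comp_mem d T)

theorem viPull_apply (V : Type) [AddCommGroup V] [Module ℂ V] (d : ℕ) (T : Module.End ℂ V)
    (f : homPoly V d) : (viPull V d T f : V → ℂ) = fun v => (f : V → ℂ) (T v) := rfl

theorem vi_trace {V : Type} [AddCommGroup V] [Module ℂ V]
    (b : Module.Basis (Fin 3) ℂ V) (d : ℕ) (T : Module.End ℂ V) (l : Fin 3 → ℂ)
    (hT : ∀ i, T (b i) = l i • b i) :
    LinearMap.trace ℂ _ (viPull V d T) =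
      ∑ s ∈ Finset.Nat.antidiagonalTuple 3 d, ∏ j, l j ^ (s j) := by
  obtain ⟨B, hB⟩ := vi_basis b d
  rw [LinearMap.trace_eq_matrix_trace ℂ B, Matrix.trace]
  have hc : ∀ j v, b.coord j (T v) = l j * b.coord j v := by
    intro j v
    have : (b.coord j).comp T = l j • b.coord j := by
      apply b.ext
      intro i
      simp [hT, Finsupp.single_apply]
      split_ifs with h
      · rw [h]
      · rfl
    simpa using LinearMap.congr_fun this v
  have h : ∀ s, viPull V d T (B s) = (∏ j, l j ^ (s.1 j)) • B s := by
    intro s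
    apply Subtype.ext
    rw [viPull_apply, Submodule.coe_smul, hB]
    ext v
    simp only [hc, mul_pow, Finset.prod_mul_distrib]
    rfl
  simp only [Matrix.diag, LinearMap.toMatrix_apply, h]
  simp
  exact Finset.sum_attach (Finset.Nat.antidiagonalTuple 3 d) (fun s => ∏ j, l j ^ (s j))

/-- complete symmetric polynomial of degree three -/
def viP3 (x y : ℂ) : ℂ := x ^ 3 - 2 * x * y + 1
/-- complete symmetric polynomial of degree six -/
def viP6 (x y : ℂ) : ℂ :=
  x ^ 6 - 5 * x ^ 4 * y + 4 * x ^ 3 + 6 * x ^ 2 * y ^ 2 - 6 * x * y - y ^ 3 + 1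

theorem vi_h3 (l : Fin 3 → ℂ) (h : l 0 * l 1 * l 2 = 1) :
    ∑ s ∈ Finset.Nat.antidiagonalTuple 3 3, ∏ j, l j ^ (s j) =
      viP3 (l 0 + l 1 + l 2) (l 0 * l 1 + l 1 * l 2 + l 2 * l 0) := by
  have : Finset.Nat.antidiagonalTuple 3 3 = {![0,0,3],![0,1,2],![0,2,1],![0,3,0],![1,0,2],![1,1,1],![1,2,0],
    ![2,0,1],![2,1,0],![3,0,0]} := by decide +kernel
  rw [this]
  repeat rw [Finset.sum_insert (by decide +kernel)]
  rw [Finset.sum_singleton]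
  simp only [Fin.prod_univ_three, viP3]
  simp
  linear_combination (1:ℂ) * h

theorem vi_h6 (l : Fin 3 → ℂ) (h : l 0 * l 1 * l 2 = 1) :
    ∑ s ∈ Finset.Nat.antidiagonalTuple 3 6, ∏ j, l j ^ (s j) =
      viP6 (l 0 + l 1 + l 2) (l 0 * l 1 + l 1 * l 2 + l 2 * l 0) := by
  have : Finset.Nat.antidiagonalTuple 3 6 = {![0,0,6],![0,1,5],![0,2,4],![0,3,3],![0,4,2],![0,5,1],![0,6,0],
    ![1,0,5],![1,1,4],![1,2,3],![1,3,2],![1,4,1],![1,5,0],![2,0,4],![2,1,3],![2,2,2],![2,3,1],![2,4,0],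
    ![3,0,3],![3,1,2],![3,2,1],![3,3,0],![4,0,2],![4,1,1],![4,2,0],![5,0,1],![5,1,0],![6,0,0]} := by decide +kernel
  rw [this]
  repeat rw [Finset.sum_insert (by decide +kernel)]
  rw [Finset.sum_singleton]
  simp only [Fin.prod_univ_three, viP6]
  simp
  generalize l 0 = a at *
  generalize l 1 = b at *
  generalize l 2 = c at *
  linear_combination (a * b * c + 1 + 4 * (a + b + c) ^ 3 - 6 * (a + b + c) * (a * b + b * c + c * a)) * h

theorem vi_n1 (a : ℂ) (h : a * a * a = 1) :
    (a + a + a) * (a * a + a * a + a * a) = 9 ∧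
    viP3 (a + a + a) (a * a + a * a + a * a) = 10 ∧
    viP6 (a + a + a) (a * a + a * a + a * a) = 28 := by
  have h3 : a ^ 3 = 1 := by linear_combination h
  unfold viP3 viP6
  refine ⟨?_, ?_, ?_⟩ <;> ring_nf
  · simp [h3]
  · simp [h3]; norm_num
  · rw [show a ^ 6 = (a ^ 3) ^ 2 by ring, h3]; norm_num

theorem vi_n2 (a b c : ℂ) (h : a * b * c = 1) (hb : a ^ 2 = b ^ 2) (hc : a ^ 2 = c ^ 2)
    (hne : ¬ (a = b ∧ a = c)) :
    (a + b + c) * (a * b + b * c + c * a) = 1 ∧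
    viP3 (a + b + c) (a * b + b * c + c * a) = -2 ∧
    viP6 (a + b + c) (a * b + b * c + c * a) = 4 := by
  unfold viP3 viP6
  rcases sq_eq_sq_iff_eq_or_eq_neg.1 hb with rfl | rfl <;>
  rcases sq_eq_sq_iff_eq_or_eq_neg.1 hc with h' | h'
  · exact absurd ⟨rfl, h'⟩ hne
  all_goals (first | subst h' | skip)
  all_goals grind

theorem vi_n4 (a b c : ℂ) (h : a * b * c = 1) (hb : a ^ 4 = b ^ 4) (hc : a ^ 4 = c ^ 4)
    (hne : ¬ (a ^ 2 = b ^ 2 ∧ a ^ 2 = c ^ 2)) :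
    (a + b + c) * (a * b + b * c + c * a) = 5 ∨
    ((a + b + c) * (a * b + b * c + c * a) = 1 ∧
    viP3 (a + b + c) (a * b + b * c + c * a) = 0 ∧
    viP6 (a + b + c) (a * b + b * c + c * a) = 0) := by
  have key : ∀ u : ℂ, a ^ 4 = u ^ 4 → u = a ∨ u = - a ∨ u = Complex.I * a ∨ u = - Complex.I * a := by
    intro u hu
    have : (u - a) * ((u + a) * ((u - Complex.I * a) * (u + Complex.I * a))) = 0 := by
      linear_combination (-1) * hu + (- a ^ 2 * u ^ 2 + a ^ 4 ) * Complex.I_sq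
    rcases mul_eq_zero.1 this with h | h
    · left; linear_combination h
    rcases mul_eq_zero.1 h with h | h
    · right; left; linear_combination h
    rcases mul_eq_zero.1 h with h | h
    · right; right; left; linear_combination h
    · right; right; right; linear_combination h
  have hI := Complex.I_sq
  generalize Complex.I = i at *
  unfold viP3 viP6
  rcases key b hb with rfl | rfl | rfl | rfl <;> rcases key c hc with rfl | rfl | rfl | rfl
  all_goals first
    | (exfalso; apply hne; constructor <;> ring; done)
    | (left; grind)
    | (right; refine ⟨?_, ?_, ?_⟩ <;> grind)

theorem vi_n5 (a b c : ℂ) (h : a * b * c = 1) (hb : a ^ 5 = b ^ 5) (hc : a ^ 5 = c ^ 5)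
    (hne : ¬ (a = b ∧ a = c)) :
    (a + b + c) * (a * b + b * c + c * a) +
      (a ^ 2 + b ^ 2 + c ^ 2) * (a ^ 2 * b ^ 2 + b ^ 2 * c ^ 2 + c ^ 2 * a ^ 2) = 8 ∨
    ((a + b + c) * (a * b + b * c + c * a) +
      (a ^ 2 + b ^ 2 + c ^ 2) * (a ^ 2 * b ^ 2 + b ^ 2 * c ^ 2 + c ^ 2 * a ^ 2) = 3 ∧
    viP3 (a + b + c) (a * b + b * c + c * a) = 0 ∧
    viP6 (a + b + c) (a * b + b * c + c * a) +
    viP6 (a ^ 2 + b ^ 2 + c ^ 2) (a ^ 2 * b ^ 2 + b ^ 2 * c ^ 2 + c ^ 2 * a ^ 2) = 1) := by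
  have ha : a ≠ 0 := by rintro rfl; simp at h
  obtain ⟨z, hz⟩ : ∃ z : ℂ, IsPrimitiveRoot z 5 := ⟨_, Complex.isPrimitiveRoot_exp 5 (by norm_num)⟩
  have key : ∀ u : ℂ, a ^ 5 = u ^ 5 → ∃ i < 5, u = z ^ i * a := by
    intro u hu
    obtain ⟨i, hi, hiu⟩ := hz.eq_pow_of_pow_eq_one (ξ := u / a)
      (by rw [div_pow, ← hu, div_self (pow_ne_zero _ ha)])
    exact ⟨i, hi, by rw [hiu]; field_simp⟩
  have hz5 := hz.pow_eq_one
  have hz4 : 1 + z + z ^ 2 + z ^ 3 + z ^ 4 = 0 := by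
    have := hz.geom_sum_eq_zero (by norm_num)
    simpa [Finset.sum_range_succ] using this
  clear hz
  obtain ⟨i, hi, rfl⟩ := key b hb
  obtain ⟨j, hj, rfl⟩ := key c hc
  clear key hb hc
  have ht : a ^ 3 * z ^ (i + j) = 1 := by rw [← h]; ring
  have hq : a ^ 3 = z ^ (4 * (i + j)) := by
    have : z ^ (i + j) * z ^ (4 * (i + j)) = 1 := by
      rw [← pow_add, show i + j + 4 * (i + j) = 5 * (i + j) by ring, pow_mul, hz5, one_pow]
    calc a ^ 3 = a ^ 3 * (z ^ (i + j) * z ^ (4 * (i + j))) := by rw [this, mul_one]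
      _ = _ := by rw [← mul_assoc, ht, one_mul]
  clear ht h
  unfold viP3 viP6
  interval_cases i <;> interval_cases j
  all_goals first
    | (exfalso; apply hne; constructor <;> ring; done)
    | clear ha hne hi hj
  all_goals norm_num at hq
  all_goals first
    | (left; grind)
    | (right; refine ⟨?_, ?_, ?_⟩ <;> grind)

theorem vi_ct (m : Multiset ℕ) (n : ℕ)
    (h : (if (m.sum ≤ Fintype.card (Fin 6) ∧ ∀ a ∈ m, 2 ≤ a) ∧ Even (m.sum + Multiset.card m) then
        (Fintype.card (Fin 6)).factorial /
          ((Fintype.card (Fin 6) - m.sum).factorial *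
            (m.prod * (∏ n ∈ m.toFinset, (m.count n).factorial)))
      else 0) = n) :
    (Finset.univ.filter (fun g : alternatingGroup (Fin 6) =>
      (g : Equiv.Perm (Fin 6)).cycleType = m)).card = n := by
  rw [AlternatingGroup.card_of_cycleType]; exact h

theorem vi_order (g : alternatingGroup (Fin 6)) (m : Multiset ℕ)
    (h : (g : Equiv.Perm (Fin 6)).cycleType = m) : orderOf g = m.lcm := by
  rw [← h, Equiv.Perm.lcm_cycleType, Subgroup.orderOf_coe]

theorem vi_cardA6 : Fintype.card (alternatingGroup (Fin 6)) = 360 := by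
  have := two_mul_card_alternatingGroup (α := Fin 6)
  rw [Fintype.card_perm, Fintype.card_fin] at this
  have h6 : Nat.factorial 6 = 720 := rfl
  omega

theorem vi_counts :
    (Finset.univ.filter (fun g : alternatingGroup (Fin 6) => orderOf g = 2)).card = 45 ∧
    (Finset.univ.filter (fun g : alternatingGroup (Fin 6) => orderOf g = 3)).card = 80 ∧
    (Finset.univ.filter (fun g : alternatingGroup (Fin 6) => orderOf g = 4)).card = 90 ∧
    (Finset.univ.filter (fun g : alternatingGroup (Fin 6) => orderOf g = 5)).card = 144 ∧
    ∀ g : alternatingGroup (Fin 6), orderOf g = 1 ∨ orderOf g = 2 ∨ orderOf g = 3 ∨ orderOf g = 4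
      ∨ orderOf g = 5 := by
  have c2 := vi_ct {2, 2} 45 (by decide)
  have c3 := vi_ct {3} 40 (by decide)
  have c33 := vi_ct {3, 3} 40 (by decide)
  have c4 := vi_ct {4, 2} 90 (by decide)
  have c5 := vi_ct {5} 144 (by decide)
  set C : Multiset ℕ → Finset (alternatingGroup (Fin 6)) := fun m =>
    Finset.univ.filter (fun g => (g : Equiv.Perm (Fin 6)).cycleType = m) with hC
  set O : ℕ → Finset (alternatingGroup (Fin 6)) := fun n => Finset.univ.filter (fun g => orderOf g = n) with hO
  have hsub : ∀ m, C m ⊆ O m.lcm := by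
    intro m g hg
    simp only [hC, hO, Finset.mem_filter, Finset.mem_univ, true_and] at hg ⊢
    exact vi_order g m hg
  have e2 : ({2, 2} : Multiset ℕ).lcm = 2 := by decide
  have e3 : ({3} : Multiset ℕ).lcm = 3 := by decide
  have e33 : ({3, 3} : Multiset ℕ).lcm = 3 := by decide
  have e4 : ({4, 2} : Multiset ℕ).lcm = 4 := by decide
  have e5 : ({5} : Multiset ℕ).lcm = 5 := by decide
  have l2 : 45 ≤ (O 2).card := by rw [← c2, ← e2]; exact Finset.card_le_card (hsub _)
  have l4 : 90 ≤ (O 4).card := by rw [← c4, ← e4]; exact Finset.card_le_card (hsub _)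
  have l5 : 144 ≤ (O 5).card := by rw [← c5, ← e5]; exact Finset.card_le_card (hsub _)
  have l3 : 80 ≤ (O 3).card := by
    have hd : Disjoint (C {3}) (C {3, 3}) := by
      rw [Finset.disjoint_left]
      intro g h1 h2
      simp only [hC, Finset.mem_filter, Finset.mem_univ, true_and] at h1 h2
      rw [h1] at h2
      exact absurd h2 (by decide)
    have : (C {3} ∪ C {3, 3}).card = 80 := by
      rw [Finset.card_union_of_disjoint hd]
      change (C {3}).card = 40 at c3
      change (C {3, 3}).card = 40 at c33
      rw [c3, c33]
    rw [← this]
    apply Finset.card_le_card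
    apply Finset.union_subset
    · have := hsub {3}; rwa [e3] at this
    · have := hsub {3, 3}; rwa [e33] at this
  have l1 : 1 ≤ (O 1).card := by
    rw [Nat.succ_le_iff, Finset.card_pos]
    exact ⟨1, by simp [hO]⟩
  have hsum : (∑ n ∈ ({1, 2, 3, 4, 5} : Finset ℕ), (O n).card) =
      (Finset.univ.filter (fun g : alternatingGroup (Fin 6) => orderOf g ∈ ({1, 2, 3, 4, 5} : Finset ℕ))).card := by
    rw [Finset.card_eq_sum_card_fiberwise (f := fun g => orderOf g) (t := {1, 2, 3, 4, 5})
      (by intro g hg; simpa using hg)]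
    refine Finset.sum_congr rfl fun n hn => ?_
    congr 1
    ext g
    simp only [hO, Finset.mem_filter, Finset.mem_univ, true_and]
    constructor
    · intro h; exact ⟨h ▸ hn, h⟩
    · intro h; exact h.2
  have hle := Finset.card_filter_le (Finset.univ : Finset (alternatingGroup (Fin 6)))
    (fun g => orderOf g ∈ ({1, 2, 3, 4, 5} : Finset ℕ))
  rw [← hsum, Finset.card_univ, vi_cardA6] at hle
  have hs : (∑ n ∈ ({1, 2, 3, 4, 5} : Finset ℕ), (O n).card) =
    (O 1).card + (O 2).card + (O 3).card + (O 4).card + (O 5).card := by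
    simp [add_assoc]
  have r : (O 2).card = 45 ∧ (O 3).card = 80 ∧ (O 4).card = 90 ∧ (O 5).card = 144 := by omega
  refine ⟨r.1, r.2.1, r.2.2.1, r.2.2.2, fun g => ?_⟩
  have heq : (Finset.univ.filter (fun g : alternatingGroup (Fin 6) =>
      orderOf g ∈ ({1, 2, 3, 4, 5} : Finset ℕ))) = Finset.univ := by
    rw [← Finset.card_eq_iff_eq_univ, vi_cardA6, ← hsum]
    omega
  have := heq ▸ Finset.mem_univ g
  simpa using this

theorem vi_toMatrix {V : Type} [AddCommGroup V] [Module ℂ V]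
    (b : Module.Basis (Fin 3) ℂ V) (T : Module.End ℂ V) (l : Fin 3 → ℂ)
    (hT : ∀ i, T (b i) = l i • b i) : LinearMap.toMatrix b b T = Matrix.diagonal l := by
  ext i j
  rw [LinearMap.toMatrix_apply, hT]
  simp only [map_smul, Module.Basis.repr_self, Finsupp.smul_apply, smul_eq_mul, Matrix.diagonal_apply,
    Finsupp.single_apply]
  by_cases h : i = j
  · subst h; simp
  · simp [h, Ne.symm h]

theorem vi_tr {V : Type} [AddCommGroup V] [Module ℂ V]
    (b : Module.Basis (Fin 3) ℂ V) (T : Module.End ℂ V) (l : Fin 3 → ℂ)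
    (hT : ∀ i, T (b i) = l i • b i) : LinearMap.trace ℂ V T = l 0 + l 1 + l 2 := by
  rw [LinearMap.trace_eq_matrix_trace ℂ b, vi_toMatrix b T l hT, Matrix.trace_diagonal,
    Fin.sum_univ_three]

theorem vi_det {V : Type} [AddCommGroup V] [Module ℂ V]
    (b : Module.Basis (Fin 3) ℂ V) (T : Module.End ℂ V) (l : Fin 3 → ℂ)
    (hT : ∀ i, T (b i) = l i • b i) : LinearMap.det T = l 0 * l 1 * l 2 := by
  rw [← LinearMap.det_toMatrix b, vi_toMatrix b T l hT, Matrix.det_diagonal,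
    Fin.prod_univ_three]

section
variable {G : Type} [Group G] {V : Type} [AddCommGroup V] [Module ℂ V]

theorem vi_eig_pow (ρ : Representation ℂ G V) (b : Module.Basis (Fin 3) ℂ V) (g : G) (l : Fin 3 → ℂ)
    (hT : ∀ i, ρ g (b i) = l i • b i) (k : ℕ) (i : Fin 3) : ρ (g ^ k) (b i) = (l i) ^ k • b i := by
  induction k with
  | zero => simp
  | succ k ih => rw [pow_succ', map_mul, Module.End.mul_apply, ih, map_smul, hT, smul_smul, pow_succ]

theorem vi_det_one (ρ : Representation ℂ G V) (hG : commutator G = ⊤) (g : G) :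
    LinearMap.det (ρ g) = 1 := by
  let f : G →* ℂ := (LinearMap.det : (V →ₗ[ℂ] V) →* ℂ).comp ρ
  have h := Abelianization.commutator_subset_ker f.toHomUnits
  rw [hG] at h
  have h1 : f.toHomUnits g = 1 := h (Subgroup.mem_top g)
  have h2 := congrArg Units.val h1
  rw [MonoidHom.coe_toHomUnits] at h2
  exact h2

theorem vi_schur [FiniteDimensional ℂ V] (ρ : Representation ℂ G V)
    (hdim : Module.finrank ℂ V = 3)
    (hirr : ∀ W : Submodule ℂ V, (∀ g : G, ∀ v ∈ W, ρ g v ∈ W) → W = ⊥ ∨ W = ⊤)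
    (z : G) (hz : z ∈ Subgroup.center G) : ∃ c : ℂ, ∀ v, ρ z v = c • v := by
  have : Nontrivial V := Module.nontrivial_of_finrank_pos (R := ℂ) (by omega)
  obtain ⟨c, hc⟩ := Module.End.exists_eigenvalue (ρ z)
  refine ⟨c, fun v => ?_⟩
  rcases hirr (Module.End.eigenspace (ρ z) c) (by
    intro g v hv
    rw [Module.End.mem_eigenspace_iff] at hv ⊢
    rw [← Module.End.mul_apply, ← map_mul, ← Subgroup.mem_center_iff.1 hz g, map_mul,
      Module.End.mul_apply, hv, map_smul]) with h | h
  · exact absurd h hc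
  · exact Module.End.mem_eigenspace_iff.1 (h ▸ Submodule.mem_top)

theorem vi_center_iff [FiniteDimensional ℂ V] (ρ : Representation ℂ G V)
    (hfaithful : Function.Injective ρ)
    (hdim : Module.finrank ℂ V = 3)
    (hirr : ∀ W : Submodule ℂ V, (∀ g : G, ∀ v ∈ W, ρ g v ∈ W) → W = ⊥ ∨ W = ⊤)
    (b : Module.Basis (Fin 3) ℂ V) (g : G) (l : Fin 3 → ℂ)
    (hT : ∀ i, ρ g (b i) = l i • b i) :
    g ∈ Subgroup.center G ↔ (l 0 = l 1 ∧ l 0 = l 2) := by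
  constructor
  · intro hg
    obtain ⟨c, hc⟩ := vi_schur ρ hdim hirr g hg
    have : ∀ i, l i = c := by
      intro i
      have h := hT i
      rw [hc] at h
      exact (smul_left_injective ℂ (b.ne_zero i) h).symm
    simp [this]
  · rintro ⟨h1, h2⟩
    have hs : ρ g = l 0 • (1 : Module.End ℂ V) := by
      apply b.ext
      intro i
      rw [hT]
      fin_cases i
      · rfl
      · simp [h1]
      · simp [h2]
    rw [Subgroup.mem_center_iff]
    intro h
    apply hfaithful
    rw [map_mul, map_mul, hs]
    simp

end

section
variable {G : Type} [Group G] [Finite G] {V : Type} [AddCommGroup V] [Module ℂ V]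
  [FiniteDimensional ℂ V]

/-- norm squared of the character -/
noncomputable def viF (ρ : Representation ℂ G V) (g : G) : ℝ := Complex.normSq (ρ.character g)

/-- the trace on homogeneous polynomials -/
noncomputable def viH (ρ : Representation ℂ G V) (d : ℕ) (g : G) : ℂ :=
  LinearMap.trace ℂ _ (viPull V d (ρ g))

theorem vi_data (ρ : Representation ℂ G V) (hG : commutator G = ⊤)
    (hfaithful : Function.Injective ρ)
    (hdim : Module.finrank ℂ V = 3)
    (hirr : ∀ W : Submodule ℂ V, (∀ g : G, ∀ v ∈ W, ρ g v ∈ W) → W = ⊥ ∨ W = ⊤) (g : G) :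
    ∃ a b c : ℂ, a * b * c = 1 ∧
      (∀ k : ℕ, g ^ k ∈ Subgroup.center G ↔ (a ^ k = b ^ k ∧ a ^ k = c ^ k)) ∧
      (∀ k : ℕ, ρ.character (g ^ k) = a ^ k + b ^ k + c ^ k) ∧
      (∀ k : ℕ, ((viF ρ (g ^ k) : ℝ) : ℂ) = (a ^ k + b ^ k + c ^ k) *
        (a ^ k * b ^ k + b ^ k * c ^ k + c ^ k * a ^ k)) ∧
      (∀ k : ℕ, viH ρ 3 (g ^ k) = viP3 (a ^ k + b ^ k + c ^ k)
        (a ^ k * b ^ k + b ^ k * c ^ k + c ^ k * a ^ k)) ∧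
      (∀ k : ℕ, viH ρ 6 (g ^ k) = viP6 (a ^ k + b ^ k + c ^ k)
        (a ^ k * b ^ k + b ^ k * c ^ k + c ^ k * a ^ k)) ∧
      ((viF ρ g : ℝ) : ℂ) = ρ.character g * ρ.character g⁻¹ ∧
      a * b + b * c + c * a = (starRingEnd ℂ) (a + b + c) := by
  have hN : Nat.card G ≠ 0 := Nat.card_pos.ne'
  obtain ⟨B, l, hl⟩ := vi_eigenbasis hdim (ρ g) (Nat.card G) hN
    (by rw [← map_pow, pow_card_eq_one', map_one])
  have hd : l 0 * l 1 * l 2 = 1 := by rw [← vi_det B _ l hl, vi_det_one ρ hG]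
  have hk := fun k => vi_eig_pow ρ B g l hl k
  have hnorm : ∀ i, ‖l i‖ = 1 := by
    intro i
    apply Complex.norm_eq_one_of_pow_eq_one _ hN
    have h := hk (Nat.card G) i
    rw [pow_card_eq_one', map_one] at h
    have h' : (l i ^ Nat.card G) • B i = (1 : ℂ) • B i := by rw [← h]; simp
    exact smul_left_injective ℂ (B.ne_zero i) h'
  have hne : ∀ i, l i ≠ 0 := fun i h => by simpa [h] using hnorm i
  have hinv : ∀ i, ρ g⁻¹ (B i) = (l i)⁻¹ • B i := by
    intro i
    have h : ρ g⁻¹ (ρ g (B i)) = B i := by simp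
    rw [hl, map_smul] at h
    conv_rhs => rw [← h]
    rw [smul_smul, inv_mul_cancel₀ (hne i), one_smul]
  have hconj : ∀ i, (starRingEnd ℂ) (l i) = (l i)⁻¹ := fun i => (Complex.inv_eq_conj (hnorm i)).symm
  have h0 := hne 0
  have h1 := hne 1
  have h2 := hne 2
  have hcs : (starRingEnd ℂ) (l 0 + l 1 + l 2) = l 0 * l 1 + l 1 * l 2 + l 2 * l 0 := by
    rw [map_add, map_add, hconj, hconj, hconj]
    field_simp
    linear_combination (-(l 0 * l 1 + l 1 * l 2 + l 2 * l 0)) * hd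
  have hcsk : ∀ k : ℕ, (starRingEnd ℂ) (l 0 ^ k + l 1 ^ k + l 2 ^ k) =
      l 0 ^ k * l 1 ^ k + l 1 ^ k * l 2 ^ k + l 2 ^ k * l 0 ^ k := by
    intro k
    have hdk : l 0 ^ k * l 1 ^ k * l 2 ^ k = 1 := by rw [← mul_pow, ← mul_pow, hd, one_pow]
    rw [map_add, map_add, map_pow, map_pow, map_pow, hconj, hconj, hconj, inv_pow, inv_pow, inv_pow]
    have h0 := pow_ne_zero k h0
    have h1 := pow_ne_zero k h1
    have h2 := pow_ne_zero k h2
    generalize l 0 ^ k = a at *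
    generalize l 1 ^ k = b at *
    generalize l 2 ^ k = c at *
    field_simp
    linear_combination (-(a * b + b * c + c * a)) * hdk
  have hch : ∀ k : ℕ, ρ.character (g ^ k) = l 0 ^ k + l 1 ^ k + l 2 ^ k := fun k =>
    vi_tr B _ (fun i => l i ^ k) (hk k)
  have hch1 : ρ.character g = l 0 + l 1 + l 2 := vi_tr B _ l hl
  have hchi : ρ.character g⁻¹ = (l 0)⁻¹ + (l 1)⁻¹ + (l 2)⁻¹ := vi_tr B _ (fun i => (l i)⁻¹) hinv
  have hdk : ∀ k, (fun i => l i ^ k) 0 * (fun i => l i ^ k) 1 * (fun i => l i ^ k) 2 = 1 := by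
    intro k; simp only; rw [← mul_pow, ← mul_pow, hd, one_pow]
  refine ⟨l 0, l 1, l 2, hd, ?_, hch, ?_, ?_, ?_, ?_, hcs.symm⟩
  · intro k
    exact vi_center_iff ρ hfaithful hdim hirr B (g ^ k) (fun i => l i ^ k) (hk k)
  · intro k
    rw [viF, hch, ← hcsk, Complex.mul_conj]
  · intro k
    rw [viH, vi_trace B 3 _ (fun i => l i ^ k) (hk k), vi_h3 _ (hdk k)]
  · intro k
    rw [viH, vi_trace B 6 _ (fun i => l i ^ k) (hk k), vi_h6 _ (hdk k)]
  · rw [viF, hchi, ← hconj, ← hconj, ← hconj, ← map_add, ← map_add, ← hch1, Complex.mul_conj]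

theorem vi_class (ρ : Representation ℂ G V) (hG : commutator G = ⊤)
    (hfaithful : Function.Injective ρ)
    (hdim : Module.finrank ℂ V = 3)
    (hirr : ∀ W : Submodule ℂ V, (∀ g : G, ∀ v ∈ W, ρ g v ∈ W) → W = ⊥ ∨ W = ⊤) (g : G) :
    (g ∈ Subgroup.center G → viF ρ g = 9 ∧ viH ρ 3 g = 10 ∧ viH ρ 6 g = 28) ∧
    (g ∉ Subgroup.center G → g ^ 2 ∈ Subgroup.center G →
      viF ρ g = 1 ∧ viH ρ 3 g = -2 ∧ viH ρ 6 g = 4) ∧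
    (viF ρ g = 0 → viH ρ 3 g = 1 ∧ viH ρ 6 g = 1) ∧
    (g ^ 2 ∉ Subgroup.center G → g ^ 4 ∈ Subgroup.center G →
      1 ≤ viF ρ g ∧ (viF ρ g = 1 → viH ρ 3 g = 0 ∧ viH ρ 6 g = 0)) ∧
    (g ∉ Subgroup.center G → g ^ 5 ∈ Subgroup.center G →
      3 ≤ viF ρ g + viF ρ (g ^ 2) ∧ (viF ρ g + viF ρ (g ^ 2) = 3 →
        viH ρ 3 g = 0 ∧ viH ρ 6 g + viH ρ 6 (g ^ 2) = 1)) := by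
  obtain ⟨a, b, c, habc, hz, hch, hF, h3, h6, -, hconj⟩ := vi_data ρ hG hfaithful hdim hirr g
  have hz1 := hz 1
  have hF1 := hF 1
  have h31 := h3 1
  have h61 := h6 1
  have hch1 := hch 1
  simp only [pow_one] at hz1 hF1 h31 h61 hch1
  refine ⟨?_, ?_, ?_, ?_, ?_⟩
  · intro h
    obtain ⟨rfl, rfl⟩ := hz1.1 h
    have := vi_n1 a habc
    rw [← h31, ← h61, ← hF1] at this
    exact ⟨by exact_mod_cast this.1, this.2⟩
  · intro h h'
    obtain ⟨e1, e2⟩ := (hz 2).1 h'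
    have := vi_n2 a b c habc e1 e2 (fun h'' => h (hz1.2 h''))
    rw [← h31, ← h61, ← hF1] at this
    exact ⟨by exact_mod_cast this.1, this.2⟩
  · intro h
    have hx : ρ.character g = 0 := Complex.normSq_eq_zero.1 h
    rw [hch1] at hx
    rw [h31, h61, hconj, hx]
    simp [viP3, viP6]
  · intro h h'
    obtain ⟨e1, e2⟩ := (hz 4).1 h'
    have := vi_n4 a b c habc e1 e2 (fun h'' => h ((hz 2).2 h''))
    rw [← h31, ← h61, ← hF1] at this
    rcases this with h5 | ⟨h5, h6⟩
    · have h5 : viF ρ g = 5 := by exact_mod_cast h5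
      rw [h5]; norm_num
    · have h5 : viF ρ g = 1 := by exact_mod_cast h5
      exact ⟨h5.ge, fun _ => h6⟩
  · intro h h'
    obtain ⟨e1, e2⟩ := (hz 5).1 h'
    have := vi_n5 a b c habc e1 e2 (fun h'' => h (hz1.2 h''))
    rw [← h31, ← h61, ← hF1, ← hF 2, ← h6 2] at this
    rcases this with h5 | ⟨h5, h6⟩
    · have h5 : viF ρ g + viF ρ (g ^ 2) = 8 := by exact_mod_cast h5
      rw [h5]; norm_num
    · have h5 : viF ρ g + viF ρ (g ^ 2) = 3 := by exact_mod_cast h5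
      exact ⟨h5.ge, fun _ => h6⟩

end

/-- the representation on homogeneous polynomials -/
noncomputable def viRep {G : Type} [Group G] {V : Type} [AddCommGroup V] [Module ℂ V]
    (ρ : Representation ℂ G V) (d : ℕ) : Representation ℂ G (homPoly V d) where
  toFun g := viPull V d (ρ g⁻¹)
  map_one' := by
    ext f v
    simp [viPull_apply]
  map_mul' g h := by
    ext f v
    simp [viPull_apply]

theorem vi_fd {V : Type} [AddCommGroup V] [Module ℂ V] [FiniteDimensional ℂ V]
    (hdim : Module.finrank ℂ V = 3) (d : ℕ) : FiniteDimensional ℂ (homPoly V d) := by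
  obtain ⟨B, -⟩ := vi_basis (Module.finBasisOfFinrankEq ℂ V hdim) d
  exact Module.Finite.of_basis B

theorem vi_dim {G : Type} [Group G] [Fintype G] {V : Type} [AddCommGroup V] [Module ℂ V]
    [FiniteDimensional ℂ V]
    (hdim : Module.finrank ℂ V = 3) (ρ : Representation ℂ G V) (d : ℕ) :
    ∑ g : G, viH ρ d g = (Nat.card G : ℂ) * Module.finrank ℂ (viRep ρ d).invariants := by
  have := vi_fd hdim d
  have hne : (Nat.card G : ℂ) ≠ 0 := by exact_mod_cast Nat.card_pos.ne'
  have : Invertible (Nat.card G : ℂ) := invertibleOfNonzero hne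
  have h := Representation.card_inv_mul_sum_char_eq_finrank (viRep ρ d)
  rw [← h, ← mul_assoc, mul_inv_cancel₀ hne, one_mul]
  exact (Equiv.sum_comp (Equiv.inv G) (fun g => viH ρ d g)).symm

theorem vi_mem_inv {G : Type} [Group G] {V : Type} [AddCommGroup V] [Module ℂ V]
    (ρ : Representation ℂ G V) (d : ℕ) (f : homPoly V d) :
    f ∈ (viRep ρ d).invariants ↔ ∀ g : G, (fun v => (f : V → ℂ) (ρ g v)) = f := by
  rw [Representation.mem_invariants]
  constructor
  · intro h g
    have := congrArg Subtype.val (h g⁻¹)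
    simpa [viRep, viPull_apply] using this
  · intro h g
    apply Subtype.ext
    exact h g⁻¹

theorem vi_norm {G : Type} [Group G] [Fintype G] {V : Type} [AddCommGroup V] [Module ℂ V]
    [FiniteDimensional ℂ V] (ρ : Representation ℂ G V) (hG : commutator G = ⊤)
    (hfaithful : Function.Injective ρ)
    (hdim : Module.finrank ℂ V = 3)
    (hirr : ∀ W : Submodule ℂ V, (∀ g : G, ∀ v ∈ W, ρ g v ∈ W) → W = ⊥ ∨ W = ⊤) :
    ∑ g : G, viF ρ g = Nat.card G := by
  have hne : (Nat.card G : ℂ) ≠ 0 := by exact_mod_cast Nat.card_pos.ne'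
  have : Invertible (Nat.card G : ℂ) := invertibleOfNonzero hne
  have hV : Nontrivial V := Module.nontrivial_of_finrank_pos (R := ℂ) (by omega)
  have hI : ρ.IsIrreducible := by
    have : Nontrivial (Subrepresentation ρ) := by
      refine ⟨⊥, ⊤, fun h => ?_⟩
      have h2 : (⊥ : Submodule ℂ V) = ⊤ := congrArg Subrepresentation.toSubmodule h
      exact bot_ne_top h2
    refine ⟨fun W => ?_⟩
    rcases hirr W.toSubmodule (fun g v hv => W.apply_mem_toSubmodule g hv) with h | h
    · left; exact Subrepresentation.toSubmodule_injective h
    · right; exact Subrepresentation.toSubmodule_injective h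
  have h := Representation.card_inv_mul_sum_char_mul_char_eq_finrank ρ ρ
  rw [Representation.IsIrreducible.finrank_intertwiningMap_self] at h
  have h2 : ∑ g : G, ((viF ρ g : ℝ) : ℂ) = Nat.card G := by
    have : ∀ g, ((viF ρ g : ℝ) : ℂ) = ρ.character g * ρ.character g⁻¹ := by
      intro g
      obtain ⟨a, b, c, -, -, -, -, -, -, h, -⟩ := vi_data ρ hG hfaithful hdim hirr g
      exact h
    simp_rw [this]
    field_simp at h
    simpa using h
  exact_mod_cast h2

theorem vi_sums {G : Type} [Group G] [Fintype G] (hG : IsTripleCoverA6 G)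
    {V : Type} [AddCommGroup V] [Module ℂ V] [FiniteDimensional ℂ V]
    (ρ : Representation ℂ G V)
    (hfaithful : Function.Injective ρ)
    (hdim : Module.finrank ℂ V = 3)
    (hirr : ∀ W : Submodule ℂ V, (∀ g : G, ∀ v ∈ W, ρ g v ∈ W) → W = ⊥ ∨ W = ⊤) :
    Nat.card G = 1080 ∧ ∑ g : G, viH ρ 3 g = 0 ∧ ∑ g : G, viH ρ 6 g = 1080 := by
  classical
  obtain ⟨hcomm, -, hZ, ⟨e⟩⟩ := hG
  let p : G →* alternatingGroup (Fin 6) := e.toMonoidHom.comp (QuotientGroup.mk' (Subgroup.center G))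
  have hsurj : Function.Surjective p := e.surjective.comp (QuotientGroup.mk'_surjective _)
  have hker : ∀ g, p g = 1 ↔ g ∈ Subgroup.center G := by
    intro g
    simp [p]
  have hcard : Nat.card G = 1080 := by
    rw [Subgroup.card_eq_card_quotient_mul_card_subgroup (Subgroup.center G), hZ,
      Nat.card_congr e.toEquiv, Nat.card_eq_fintype_card, vi_cardA6]
  have hfib : ∀ a, (Finset.univ.filter (fun g => p g = a)).card = 3 := by
    intro a
    have h1 : (Finset.univ.filter (fun g => p g = 1)).card = 3 := by
      rw [← hZ, Nat.card_eq_fintype_card, Fintype.card_subtype]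
      congr 1
      ext g
      simp [hker]
    rw [← h1]
    exact MonoidHom.card_fiber_eq_of_mem_range p (hsurj a) (hsurj 1)
  let S : ℕ → Finset G := fun n => Finset.univ.filter (fun g => orderOf (p g) = n)
  have hS : ∀ n g, g ∈ S n ↔ orderOf (p g) = n := by intro n g; simp [S]
  have hScard : ∀ n, (S n).card =
      3 * (Finset.univ.filter (fun a : alternatingGroup (Fin 6) => orderOf a = n)).card := by
    intro n
    rw [Finset.card_eq_sum_card_fiberwise (f := p)
      (t := Finset.univ.filter (fun a : alternatingGroup (Fin 6) => orderOf a = n))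
      (by intro g hg; simpa [S] using hg), mul_comm, ← smul_eq_mul, ← Finset.sum_const]
    refine Finset.sum_congr rfl fun a ha => ?_
    rw [← hfib a]
    congr 1
    ext g
    simp only [Finset.mem_filter, Finset.mem_univ, true_and, hS] at ha ⊢
    constructor
    · intro h; exact h.2
    · intro h; exact ⟨h ▸ ha, h⟩
  obtain ⟨c2, c3, c4, c5, hall⟩ := vi_counts
  have k1 : (S 1).card = 3 := by
    rw [← hfib 1]
    congr 1
    ext g
    simp [hS]
  have k2 : (S 2).card = 135 := by rw [hScard, c2]
  have k3 : (S 3).card = 240 := by rw [hScard, c3]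
  have k4 : (S 4).card = 270 := by rw [hScard, c4]
  have k5 : (S 5).card = 432 := by rw [hScard, c5]
  have hpow : ∀ g k, g ^ k ∈ Subgroup.center G ↔ orderOf (p g) ∣ k := by
    intro g k
    rw [← hker, map_pow, orderOf_dvd_iff_pow_eq_one]
  have hpow1 : ∀ g, g ∈ Subgroup.center G ↔ orderOf (p g) ∣ 1 := by
    intro g
    rw [← hpow, pow_one]
  have split : ∀ {M : Type} [AddCommMonoid M] (f : G → M), ∑ g, f g = ∑ g ∈ S 1, f g + (∑ g ∈ S 2, f g +
      (∑ g ∈ S 3, f g + (∑ g ∈ S 4, f g + ∑ g ∈ S 5, f g))) := by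
    intro M _ f
    rw [← Finset.sum_fiberwise_of_maps_to (s := Finset.univ) (t := ({1, 2, 3, 4, 5} : Finset ℕ))
      (g := fun g => orderOf (p g)) (by intro g _; simpa using hall (p g))]
    simp [S]
  have hsq : ∀ {M : Type} [AddCommMonoid M] (f : G → M), ∑ g ∈ S 5, f (g ^ 2) = ∑ g ∈ S 5, f g := by
    intro M _ f
    have h15 : ∀ g ∈ S 5, g ^ 15 = 1 := by
      intro g hg
      rw [hS] at hg
      have h5 : g ^ 5 ∈ Subgroup.center G := (hpow g 5).2 (by rw [hg])
      have := pow_card_eq_one' (G := Subgroup.center G) (x := ⟨g ^ 5, h5⟩)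
      rw [hZ] at this
      have := congrArg Subtype.val this
      simpa [← pow_mul] using this
    have hm : ∀ k, Nat.Coprime 5 k → ∀ g ∈ S 5, g ^ k ∈ S 5 := by
      intro k hk g hg
      rw [hS] at hg ⊢
      rw [map_pow, Nat.Coprime.orderOf_pow (by rw [hg]; exact hk), hg]
    have h16 : ∀ g ∈ S 5, g ^ 16 = g := by
      intro g hg
      rw [pow_succ, h15 g hg, one_mul]
    refine Finset.sum_nbij' (fun g => g ^ 2) (fun g => g ^ 8) (hm 2 (by norm_num)) (hm 8 (by norm_num))
      ?_ ?_ (fun _ _ => rfl)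
    · intro g hg; simp only [← pow_mul]; exact h16 g hg
    · intro g hg; simp only [← pow_mul]; exact h16 g hg
  have hcl := fun g => vi_class ρ hcomm hfaithful hdim hirr g
  have p1 : ∀ g ∈ S 1, viF ρ g = 9 ∧ viH ρ 3 g = 10 ∧ viH ρ 6 g = 28 := by
    intro g hg
    rw [hS] at hg
    exact (hcl g).1 ((hpow1 g).2 (by rw [hg]))
  have p2 : ∀ g ∈ S 2, viF ρ g = 1 ∧ viH ρ 3 g = -2 ∧ viH ρ 6 g = 4 := by
    intro g hg
    rw [hS] at hg
    exact (hcl g).2.1 (by rw [hpow1, hg]; norm_num) (by rw [hpow, hg])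
  have p3 : ∀ g ∈ S 3, viF ρ g = 0 → viH ρ 3 g = 1 ∧ viH ρ 6 g = 1 := fun g _ => (hcl g).2.2.1
  have p4 : ∀ g ∈ S 4, 1 ≤ viF ρ g ∧ (viF ρ g = 1 → viH ρ 3 g = 0 ∧ viH ρ 6 g = 0) := by
    intro g hg
    rw [hS] at hg
    exact (hcl g).2.2.2.1 (by rw [hpow, hg]; norm_num) (by rw [hpow, hg])
  have p5 : ∀ g ∈ S 5, 3 ≤ viF ρ g + viF ρ (g ^ 2) ∧ (viF ρ g + viF ρ (g ^ 2) = 3 →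
        viH ρ 3 g = 0 ∧ viH ρ 6 g + viH ρ 6 (g ^ 2) = 1) := by
    intro g hg
    rw [hS] at hg
    exact (hcl g).2.2.2.2 (by rw [hpow1, hg]; norm_num) (by rw [hpow, hg])
  have hn := vi_norm ρ hcomm hfaithful hdim hirr
  rw [hcard, split] at hn
  have s1 : ∑ g ∈ S 1, viF ρ g = 27 := by
    rw [Finset.sum_congr rfl (fun g hg => (p1 g hg).1), Finset.sum_const, k1]; norm_num
  have s2 : ∑ g ∈ S 2, viF ρ g = 135 := by
    rw [Finset.sum_congr rfl (fun g hg => (p2 g hg).1), Finset.sum_const, k2]; norm_num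
  have n3 : ∀ g ∈ S 3, 0 ≤ viF ρ g := fun g _ => Complex.normSq_nonneg _
  have s3 : 0 ≤ ∑ g ∈ S 3, viF ρ g := Finset.sum_nonneg n3
  have s4 : ∑ g ∈ S 4, (1 : ℝ) ≤ ∑ g ∈ S 4, viF ρ g := Finset.sum_le_sum fun g hg => (p4 g hg).1
  have t4 : ∑ g ∈ S 4, (1 : ℝ) = 270 := by rw [Finset.sum_const, k4]; norm_num
  have s5 : ∑ g ∈ S 5, (3 : ℝ) ≤ ∑ g ∈ S 5, (viF ρ g + viF ρ (g ^ 2)) :=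
    Finset.sum_le_sum fun g hg => (p5 g hg).1
  have t5 : ∑ g ∈ S 5, (3 : ℝ) = 1296 := by rw [Finset.sum_const, k5]; norm_num
  have u5 : ∑ g ∈ S 5, (viF ρ g + viF ρ (g ^ 2)) = 2 * ∑ g ∈ S 5, viF ρ g := by
    rw [Finset.sum_add_distrib, hsq (fun g => viF ρ g)]; ring
  push_cast at hn
  have q3 : ∀ g ∈ S 3, viF ρ g = 0 :=
    (Finset.sum_eq_zero_iff_of_nonneg n3).1 (by linarith)
  have q4 : ∀ g ∈ S 4, 1 = viF ρ g :=
    (Finset.sum_eq_sum_iff_of_le (fun g hg => (p4 g hg).1)).1 (by linarith)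
  have q5 : ∀ g ∈ S 5, 3 = viF ρ g + viF ρ (g ^ 2) :=
    (Finset.sum_eq_sum_iff_of_le (fun g hg => (p5 g hg).1)).1 (by linarith)
  refine ⟨hcard, ?_, ?_⟩
  · rw [split, Finset.sum_congr rfl (fun g hg => (p1 g hg).2.1),
      Finset.sum_congr (s₁ := S 2) rfl (fun g hg => (p2 g hg).2.1),
      Finset.sum_congr (s₁ := S 3) rfl (fun g hg => (p3 g hg (q3 g hg)).1),
      Finset.sum_congr (s₁ := S 4) rfl (fun g hg => ((p4 g hg).2 (q4 g hg).symm).1),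
      Finset.sum_congr (s₁ := S 5) rfl (fun g hg => ((p5 g hg).2 (q5 g hg).symm).1)]
    simp only [Finset.sum_const, k1, k2, k3, k4, k5]
    norm_num
  · have w5 : 2 * ∑ g ∈ S 5, viH ρ 6 g = 432 := by
      have : ∑ g ∈ S 5, (viH ρ 6 g + viH ρ 6 (g ^ 2)) = 2 * ∑ g ∈ S 5, viH ρ 6 g := by
        rw [Finset.sum_add_distrib, hsq (fun g => viH ρ 6 g)]; ring
      rw [← this, Finset.sum_congr (s₁ := S 5) rfl (fun g hg => ((p5 g hg).2 (q5 g hg).symm).2),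
        Finset.sum_const, k5]
      norm_num
    rw [split, Finset.sum_congr rfl (fun g hg => (p1 g hg).2.2),
      Finset.sum_congr (s₁ := S 2) rfl (fun g hg => (p2 g hg).2.2),
      Finset.sum_congr (s₁ := S 3) rfl (fun g hg => (p3 g hg (q3 g hg)).2),
      Finset.sum_congr (s₁ := S 4) rfl (fun g hg => ((p4 g hg).2 (q4 g hg).symm).2)]
    simp only [Finset.sum_const, k1, k2, k3, k4]
    norm_num
    linear_combination (1 / 2 : ℂ) * w5

theorem vi_homog {V : Type} [AddCommGroup V] [Module ℂ V] (d : ℕ) (f : V → ℂ) (hf : f ∈ homPoly V d)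
    (c : ℂ) (v : V) : f (c • v) = c ^ d * f v := by
  unfold homPoly at hf
  induction hf using Submodule.span_induction with
  | mem f h =>
    obtain ⟨φ, rfl⟩ := h
    simp [Finset.prod_mul_distrib]
  | zero => simp
  | add f g _ _ h1 h2 => simp [h1, h2, mul_add]
  | smul a f _ h => simp only [Pi.smul_apply, smul_eq_mul, h]; ring


theorem vi_fr1 {E : Type*} [AddCommGroup E] [Module ℂ E] (W : Submodule ℂ E)
    (h : Module.finrank ℂ W = 1) : ∃ v : W, v ≠ 0 ∧ ∀ w : W, ∃ c : ℂ, c • v = w :=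
  finrank_eq_one_iff'.1 h

/-- Let `V` be a faithful irreducible three-dimensional complex representation of the
quasi-simple group `3.A₆` (the Valentiner group).  Then there are no nonzero `3.A₆`-invariant
homogeneous polynomial functions on `V` of degree `1`, `2`, `3`, `4` or `5`, and the space of
invariant homogeneous polynomial functions of degree `6` is one-dimensional. -/
theorem valentiner_invariants
    (G : Type) [Group G] [Finite G] (hG : IsTripleCoverA6 G)
    (V : Type) [AddCommGroup V] [Module ℂ V] [FiniteDimensional ℂ V]
    (ρ : Representation ℂ G V)
    (hfaithful : Function.Injective ρ)
    (hdim : Module.finrank ℂ V = 3)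
    (hirr : ∀ W : Submodule ℂ V, (∀ g : G, ∀ v ∈ W, ρ g v ∈ W) → W = ⊥ ∨ W = ⊤) :
    (∀ d : ℕ, 1 ≤ d → d ≤ 5 →
      ∀ f ∈ homPoly V d, (∀ g : G, (fun v => f (ρ g v)) = f) → f = 0) ∧
    (∃ f₀ ∈ homPoly V 6, f₀ ≠ 0 ∧ (∀ g : G, (fun v => f₀ (ρ g v)) = f₀) ∧
      ∀ f ∈ homPoly V 6, (∀ g : G, (fun v => f (ρ g v)) = f) → ∃ c : ℂ, f = c • f₀) := by
  have : Fintype G := Fintype.ofFinite G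
  obtain ⟨hcard, hs3, hs6⟩ := vi_sums hG ρ hfaithful hdim hirr
  rw [vi_dim hdim, hcard] at hs3 hs6
  have hd3 : Module.finrank ℂ (viRep ρ 3).invariants = 0 := by
    have : (Module.finrank ℂ (viRep ρ 3).invariants : ℂ) = 0 := by
      simpa using hs3
    exact_mod_cast this
  have hd6 : Module.finrank ℂ (viRep ρ 6).invariants = 1 := by
    have : (Module.finrank ℂ (viRep ρ 6).invariants : ℂ) = 1 := by
      have h : ((1080 : ℕ) : ℂ) ≠ 0 := by norm_num
      apply mul_left_cancel₀ h
      rw [hs6]; norm_num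
    exact_mod_cast this
  have hfd3 := vi_fd hdim 3
  have hfd6 := vi_fd hdim 6
  constructor
  · intro d hd1 hd5 f hf hinv
    by_cases h3 : d = 3
    · subst h3
      have hm : (⟨f, hf⟩ : homPoly V 3) ∈ (viRep ρ 3).invariants := (vi_mem_inv ρ 3 ⟨f, hf⟩).2 hinv
      rw [Submodule.finrank_eq_zero.1 hd3, Submodule.mem_bot] at hm
      exact congrArg Subtype.val hm
    · obtain ⟨-, -, hZ, -⟩ := hG
      have hnt : Nontrivial (Subgroup.center G) := by
        apply (Finite.one_lt_card_iff_nontrivial).1; omega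
      obtain ⟨⟨z, hz⟩, hz1⟩ := exists_ne (1 : Subgroup.center G)
      obtain ⟨c, hc⟩ := vi_schur ρ hdim hirr z hz
      have hV : Nontrivial V := Module.nontrivial_of_finrank_pos (R := ℂ) (by omega)
      obtain ⟨v0, hv0⟩ := exists_ne (0 : V)
      have hz3 : z ^ 3 = 1 := by
        have := pow_card_eq_one' (G := Subgroup.center G) (x := ⟨z, hz⟩)
        rw [hZ] at this
        exact congrArg Subtype.val this
      have hc3 : c ^ 3 = 1 := by
        have h : ρ (z ^ 3) v0 = (c ^ 3) • v0 := by
          simp only [pow_succ, pow_zero, one_mul, map_mul, Module.End.mul_apply, hc, map_smul, smul_smul, mul_assoc]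
        rw [hz3, map_one] at h
        have h' : (c ^ 3) • v0 = (1 : ℂ) • v0 := by rw [← h]; simp
        exact smul_left_injective ℂ hv0 h'
      have hc1 : c ≠ 1 := by
        rintro rfl
        apply hz1
        apply Subtype.ext
        apply hfaithful
        ext v
        simp [hc]
      have hcd : c ^ d ≠ 1 := by
        intro h
        apply hc1
        have h4 : c ^ 4 = c := by rw [pow_succ, hc3, one_mul]
        interval_cases d
        · simpa using h
        · calc c = c ^ 4 := h4.symm
            _ = (c ^ 2) ^ 2 := by ring
            _ = 1 := by rw [h]; norm_num
        · exact absurd rfl h3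
        · rw [← h4, h]
        · calc c = c ^ 4 := h4.symm
            _ = c ^ 4 * (c ^ 3) ^ 2 := by rw [hc3]; ring
            _ = (c ^ 5) ^ 2 := by ring
            _ = 1 := by rw [h]; norm_num
      ext v
      have h := congrFun (hinv z) v
      simp only [hc] at h
      rw [vi_homog d f hf] at h
      have h' : (c ^ d - 1) * f v = 0 := by linear_combination h
      rcases mul_eq_zero.1 h' with h'' | h''
      · exact absurd (sub_eq_zero.1 h'') hcd
      · simpa using h''
  · obtain ⟨⟨f0, hf0⟩, hne, hspan⟩ := vi_fr1 (E := homPoly V 6) (viRep ρ 6).invariants hd6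
    refine ⟨f0, f0.2, ?_, (vi_mem_inv ρ 6 f0).1 hf0, ?_⟩
    · intro h
      apply hne
      apply Subtype.ext
      apply Subtype.ext
      exact h
    · intro f hf hinv
      obtain ⟨c, hc⟩ := hspan ⟨⟨f, hf⟩, (vi_mem_inv ρ 6 ⟨f, hf⟩).2 hinv⟩
      refine ⟨c, ?_⟩
      have := congrArg (fun x => ((x : (viRep ρ 6).invariants) : homPoly V 6).1) hc
      exact this.symm
end
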